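/- Liouville theorem in the half space: let s ∈ (0,1) and let ᾱ > 0 be the boundary Harnack exponent for the class L_*(s). Suppose u ∈ C(ℝⁿ) satisfies, in the viscosity sense, M⁺{u(·+h) − u} ≥ 0 and M⁻{u(·+h) − u} ≤ 0 in {x_n > 0} for all h ∈ ℝⁿ with h_n ≥ 0, and u = 0 in {x_n < 0}. Assume that for some β ∈ (0,1) and α ∈ (0,ᾱ), the Hölder seminorm bound [u/(x_n)_+^s]_{C^β(B_R)} ≤ C R^α holds for all R ≥ 1. Then u(x) = ((x_n)_+)^s (p·x + b) for some p ∈ ℝⁿ and b ∈ ℝ. -/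

import Mathlib

open MeasureTheory Metric Set
open scoped RealInnerProductSpace

/-- Spectral measures of the class `L_*`: measurable, even, `lam ≤ μ ≤ Lam` on the sphere. -/
def SpecOK (n : ℕ) (lam Lam : ℝ) (μ : EuclideanSpace ℝ (Fin n) → ℝ) : Prop :=
  Measurable μ ∧ ∀ θ : EuclideanSpace ℝ (Fin n), ‖θ‖ = 1 →
    μ (-θ) = μ θ ∧ lam ≤ μ θ ∧ μ θ ≤ Lam

/-- The operator of the class `L_*(s)` with spectral measure `μ`. -/
noncomputable def kerOp (n : ℕ) (s : ℝ) (μ u : EuclideanSpace ℝ (Fin n) → ℝ)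
    (x : EuclideanSpace ℝ (Fin n)) : ℝ :=
  (1 - s) * ∫ y : EuclideanSpace ℝ (Fin n),
    ((u (x + y) + u (x - y)) / 2 - u x) * μ (‖y‖⁻¹ • y) / ‖y‖ ^ ((n : ℝ) + 2 * s)

/-- Extremal operator `M⁺` of the class `L_*(s)`. -/
noncomputable def Mplus (n : ℕ) (s lam Lam : ℝ) (u : EuclideanSpace ℝ (Fin n) → ℝ)
    (x : EuclideanSpace ℝ (Fin n)) : ℝ :=
  sSup {z : ℝ | ∃ μ, SpecOK n lam Lam μ ∧ z = kerOp n s μ u x}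

/-- Extremal operator `M⁻` of the class `L_*(s)`. -/
noncomputable def Mminus (n : ℕ) (s lam Lam : ℝ) (u : EuclideanSpace ℝ (Fin n) → ℝ)
    (x : EuclideanSpace ℝ (Fin n)) : ℝ :=
  sInf {z : ℝ | ∃ μ, SpecOK n lam Lam μ ∧ z = kerOp n s μ u x}

/-- `w` satisfies `M⁺ w ≥ 0` in `Ω` in the viscosity sense: whenever a `C²` function `φ`
touches `w` from above at `x` in a ball contained in `Ω`, the operator evaluated on
`φ` in the ball and `w` outside is nonnegative at `x`. -/
def ViscSub (n : ℕ) (s lam Lam : ℝ) (w : EuclideanSpace ℝ (Fin n) → ℝ)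
    (Ω : Set (EuclideanSpace ℝ (Fin n))) : Prop :=
  ∀ x ∈ Ω, ∀ r : ℝ, 0 < r → ball x r ⊆ Ω →
    ∀ φ : EuclideanSpace ℝ (Fin n) → ℝ, ContDiffOn ℝ 2 φ (ball x r) → φ x = w x →
      (∀ y ∈ ball x r, w y ≤ φ y) →
      0 ≤ Mplus n s lam Lam (fun y => if ‖y - x‖ < r then φ y else w y) x

/-- `w` satisfies `M⁻ w ≤ 0` in `Ω` in the viscosity sense: whenever a `C²` function `φ`
touches `w` from below at `x` in a ball contained in `Ω`, the operator evaluated on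
`φ` in the ball and `w` outside is nonpositive at `x`. -/
def ViscSuper (n : ℕ) (s lam Lam : ℝ) (w : EuclideanSpace ℝ (Fin n) → ℝ)
    (Ω : Set (EuclideanSpace ℝ (Fin n))) : Prop :=
  ∀ x ∈ Ω, ∀ r : ℝ, 0 < r → ball x r ⊆ Ω →
    ∀ φ : EuclideanSpace ℝ (Fin n) → ℝ, ContDiffOn ℝ 2 φ (ball x r) → φ x = w x →
      (∀ y ∈ ball x r, φ y ≤ w y) →
      Mminus n s lam Lam (fun y => if ‖y - x‖ < r then φ y else w y) x ≤ 0

/-- positive part to the power `s` -/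
noncomputable def pp (s z : ℝ) : ℝ := (max z 0) ^ s

/-- positive part to the power `s - 1`, zero on the nonpositive axis -/
noncomputable def ee (s z : ℝ) : ℝ := if 0 < z then z ^ (s - 1) else 0

noncomputable def hh (s a y : ℝ) : ℝ := (ee s (a + y) - ee s (a - y)) * y ^ (-(2 * s))

lemma pp_cont {s : ℝ} (hs : 0 < s) : Continuous (pp s) := by
  unfold pp
  exact (continuous_id.max continuous_const).rpow_const (fun x => Or.inr hs.le)

lemma pp_nonneg (s z : ℝ) : 0 ≤ pp s z := Real.rpow_nonneg (le_max_right _ _) _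

lemma pp_of_pos {s z : ℝ} (hz : 0 < z) : pp s z = z ^ s := by
  unfold pp; rw [max_eq_left hz.le]

lemma pp_of_nonpos {s z : ℝ} (hs : 0 < s) (hz : z ≤ 0) : pp s z = 0 := by
  unfold pp; rw [max_eq_right hz, Real.zero_rpow hs.ne']

lemma ee_of_pos {s z : ℝ} (hz : 0 < z) : ee s z = z ^ (s - 1) := by
  unfold ee; rw [if_pos hz]

lemma ee_of_nonpos {s z : ℝ} (hz : z ≤ 0) : ee s z = 0 := by
  unfold ee; rw [if_neg (not_lt.2 hz)]

lemma ee_nonneg (s z : ℝ) : 0 ≤ ee s z := by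
  unfold ee; split_ifs with h
  · exact Real.rpow_nonneg h.le _
  · exact le_rfl

lemma ee_meas (s : ℝ) : Measurable (ee s) := by
  unfold ee
  exact Measurable.ite measurableSet_Ioi (by fun_prop) measurable_const

lemma ee_intervalIntegrable {s : ℝ} (hs : 0 < s) (p q : ℝ) :
    IntervalIntegrable (ee s) volume p q := by
  have h1 : IntervalIntegrable (fun x : ℝ => x ^ (s - 1)) volume p q :=
    intervalIntegral.intervalIntegrable_rpow' (by linarith)
  refine h1.mono_fun (ee_meas s).aestronglyMeasurable ?_
  refine Filter.Eventually.of_forall fun z => ?_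
  simp only [ee]
  split_ifs with h
  · exact le_rfl
  · simp

lemma pp_hasDerivAt {s z : ℝ} (hs : 0 < s) (hz : z ≠ 0) : HasDerivAt (pp s) (s * ee s z) z := by
  rcases lt_or_gt_of_ne hz with h | h
  · rw [ee_of_nonpos h.le, mul_zero]
    have : pp s =ᶠ[nhds z] fun _ => 0 := by
      filter_upwards [Iio_mem_nhds h] with w hw
      exact pp_of_nonpos hs (le_of_lt hw)
    exact (hasDerivAt_const z (0:ℝ)).congr_of_eventuallyEq this
  · rw [ee_of_pos h]
    have : pp s =ᶠ[nhds z] fun w => w ^ s := by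
      filter_upwards [Ioi_mem_nhds h] with w hw
      exact pp_of_pos hw
    exact (Real.hasDerivAt_rpow_const (Or.inl h.ne')).congr_of_eventuallyEq this

lemma ee_integral {s : ℝ} (hs : 0 < s) (p q : ℝ) :
    ∫ z in p..q, s * ee s z = pp s q - pp s p := by
  apply MeasureTheory.integral_eq_of_hasDerivAt_off_countable (pp s) _ (countable_singleton (0:ℝ))
  · exact (pp_cont hs).continuousOn
  · intro x hx
    exact pp_hasDerivAt hs (by simpa using hx.2)
  · exact (ee_intervalIntegrable hs p q).const_mul s

lemma hh_meas (s a : ℝ) : Measurable (hh s a) := by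
  have := ee_meas s
  unfold hh
  fun_prop

lemma hh_scale (s : ℝ) {a y : ℝ} (ha : 0 < a) (hy : 0 < y) :
    hh s a (a * y) = a ^ (-1 - s) * hh s 1 y := by
  have e1 : ∀ z : ℝ, ee s (a * z) = a ^ (s - 1) * ee s z := by
    intro z
    unfold ee
    by_cases h : 0 < z
    · rw [if_pos h, if_pos (mul_pos ha h), Real.mul_rpow ha.le h.le]
    · rw [if_neg h, if_neg, mul_zero]
      intro h'
      exact h (pos_of_mul_pos_right h' ha.le)
  unfold hh
  rw [show a + a * y = a * (1 + y) by ring, show a - a * y = a * (1 - y) by ring, e1, e1,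
    Real.mul_rpow ha.le hy.le, show (-1 - s) = (s - 1) + -(2 * s) by ring, Real.rpow_add ha]
  ring

lemma rpow_lip {s : ℝ} (hs0 : 0 < s) (hs1 : s < 1) {y : ℝ} (hy : 0 < y) (hy2 : y ≤ 1 / 2) :
    |(1 + y) ^ (s - 1) - (1 - y) ^ (s - 1)| ≤ 8 * y := by
  have := (convex_Icc (1/2 : ℝ) (3/2)).norm_image_sub_le_of_norm_hasDerivWithin_le
    (f := fun z : ℝ => z ^ (s - 1)) (f' := fun z => (s - 1) * z ^ (s - 1 - 1)) (C := 4)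
    (x := 1 - y) (y := 1 + y) ?_ ?_ ⟨by linarith, by linarith⟩ ⟨by linarith, by linarith⟩
  · simp only [Real.norm_eq_abs] at this
    rw [show 1 + y - (1 - y) = 2 * y by ring, abs_of_pos (show (0:ℝ) < 2 * y by linarith)] at this
    linarith
  · intro z hz
    exact (Real.hasDerivAt_rpow_const (Or.inl (by linarith [hz.1]))).hasDerivWithinAt
  · intro z hz
    have hz0 : (0:ℝ) < z := by linarith [hz.1]
    rw [norm_mul, Real.norm_eq_abs, Real.norm_eq_abs, abs_of_neg (by linarith),
      abs_of_nonneg (Real.rpow_nonneg hz0.le _)]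
    have h1 : z ^ (s - 1 - 1) ≤ (1/2 : ℝ) ^ (s - 1 - 1) :=
      Real.rpow_le_rpow_of_nonpos (by norm_num) hz.1 (by linarith)
    have h2 : (1/2 : ℝ) ^ (s - 1 - 1) ≤ (1/2 : ℝ) ^ (-2 : ℝ) :=
      Real.rpow_le_rpow_of_exponent_ge (by norm_num) (by norm_num) (by linarith)
    have h3 : (1/2 : ℝ) ^ (-2 : ℝ) = 4 := by
      rw [show (-2:ℝ) = ((-2:ℤ):ℝ) by norm_num, Real.rpow_intCast]; norm_num
    have h4 := Real.rpow_nonneg hz0.le (s - 1 - 1)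
    nlinarith

lemma hh_integrable_one {s : ℝ} (hs0 : 0 < s) (hs1 : s < 1) : IntegrableOn (hh s 1) (Ioi 0) := by
  have hU : (Ioi (0:ℝ)) = Ioc 0 (1/2) ∪ (Ioc (1/2) 2 ∪ Ioi 2) := by
    rw [Ioc_union_Ioi_eq_Ioi (by norm_num), Ioc_union_Ioi_eq_Ioi (by norm_num)]
  rw [hU]
  refine IntegrableOn.union ?_ (IntegrableOn.union ?_ ?_)
  · have h1 : IntegrableOn (fun y : ℝ => 8 * y ^ (1 - 2 * s)) (Ioc 0 (1/2)) := by
      have := (intervalIntegral.intervalIntegrable_rpow' (a := 0) (b := 1/2) (r := 1 - 2 * s)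
        (by linarith)).const_mul 8
      rwa [intervalIntegrable_iff_integrableOn_Ioc_of_le (by norm_num)] at this
    refine Integrable.mono' h1 (hh_meas s 1).aestronglyMeasurable ?_
    refine (ae_restrict_iff' measurableSet_Ioc).2 (Filter.Eventually.of_forall fun y hy => ?_)
    have hy0 := hy.1
    have hy2 := hy.2
    unfold hh
    rw [ee_of_pos (by linarith), ee_of_pos (by linarith), norm_mul, Real.norm_eq_abs,
      Real.norm_eq_abs, abs_of_nonneg (Real.rpow_nonneg hy0.le _), sub_eq_add_neg 1 (2 * s),
      Real.rpow_add hy0, Real.rpow_one, ← mul_assoc]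
    exact mul_le_mul_of_nonneg_right (rpow_lip hs0 hs1 hy0 hy2) (Real.rpow_nonneg hy0.le _)
  · rw [← intervalIntegrable_iff_integrableOn_Ioc_of_le (by norm_num)]
    unfold hh
    refine IntervalIntegrable.mul_continuousOn ?_ ?_
    · refine IntervalIntegrable.sub ?_ ?_
      · have := (ee_intervalIntegrable hs0 (1 + 1/2) (1 + 2)).comp_add_left 1
        simpa using this
      · have := (ee_intervalIntegrable hs0 (1 - 1/2) (1 - 2)).comp_sub_left 1
        simpa using this
    · intro y hy
      rw [uIcc_of_le (by norm_num)] at hy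
      exact (Real.continuousAt_rpow_const _ _ (Or.inl (by linarith [hy.1]))).continuousWithinAt
  · have h1 := integrableOn_Ioi_rpow_of_lt (a := -1 - s) (c := 2) (by linarith) (by norm_num)
    refine Integrable.mono' h1 (hh_meas s 1).aestronglyMeasurable ?_
    refine (ae_restrict_iff' measurableSet_Ioi).2 (Filter.Eventually.of_forall fun y hy => ?_)
    have hy2 : (2:ℝ) < y := hy
    have hy0 : 0 < y := by linarith
    unfold hh
    rw [ee_of_pos (by linarith), ee_of_nonpos (by linarith), sub_zero, norm_mul, Real.norm_eq_abs,
      Real.norm_eq_abs, abs_of_nonneg (Real.rpow_nonneg hy0.le _),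
      abs_of_nonneg (Real.rpow_nonneg (by linarith) _),
      show (-1 - s) = (s - 1) + -(2 * s) by ring, Real.rpow_add hy0]
    exact mul_le_mul_of_nonneg_right (Real.rpow_le_rpow_of_nonpos hy0 (by linarith) (by linarith))
      (Real.rpow_nonneg hy0.le _)

lemma hh_trunc {s : ℝ} (hs0 : 0 < s) (hs1 : s < 1) {δ : ℝ} (hδ : 0 < δ) (hδ1 : δ ≤ 1 / 2) :
    ∫ y in Ioi δ, hh s 1 y = ∫ r in (δ / (1 + δ))..δ, (1 - r) ^ (s - 1) * r ^ (-(2 * s)) := by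
  -- the substitution
  set g : ℝ → ℝ := fun r => ee s (1 - r) * r ^ (-(2 * s)) with hg
  have hδ' : 0 < δ / (1 + δ) := by positivity
  have hlt : δ / (1 + δ) ≤ δ := by
    rw [div_le_iff₀ (by linarith)]; nlinarith
  have himg : (fun y : ℝ => y / (1 + y)) '' (Ioi δ) = Ioo (δ / (1 + δ)) 1 := by
    ext r
    simp only [mem_image, mem_Ioi, mem_Ioo]
    constructor
    · rintro ⟨y, hy, rfl⟩
      have : 0 < 1 + y := by linarith
      constructor
      · rw [div_lt_div_iff₀ (by linarith) this]; nlinarith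
      · rw [div_lt_one this]; linarith
    · rintro ⟨h1, h2⟩
      have h3 : 0 < 1 - r := by linarith
      refine ⟨r / (1 - r), ?_, ?_⟩
      · rw [div_lt_iff₀ (by linarith)] at h1
        rw [lt_div_iff₀ h3]; nlinarith
      · field_simp
        ring
  have hsub : ∫ r in Ioo (δ / (1 + δ)) 1, g r
      = ∫ y in Ioi δ, ee s (1 + y) * y ^ (-(2 * s)) := by
    rw [← himg, integral_image_eq_integral_abs_deriv_smul (f' := fun y => 1 / (1 + y) ^ 2)
      measurableSet_Ioi]
    · refine setIntegral_congr_fun measurableSet_Ioi fun y hy => ?_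
      have hy' : δ < y := hy
      have hy0 : 0 < y := by linarith
      have h1 : 0 < 1 + y := by linarith
      have h2 : 1 - y / (1 + y) = (1 + y)⁻¹ := by field_simp; ring
      simp only [hg]
      rw [h2, ee_of_pos (by positivity), ee_of_pos h1, Real.inv_rpow h1.le,
        Real.div_rpow hy0.le h1.le, abs_of_pos (by positivity), smul_eq_mul, div_eq_mul_inv 
          (y ^ (-(2 * s))), ← Real.rpow_neg h1.le, ← Real.rpow_neg h1.le, one_div,
          ← Real.rpow_natCast, ← Real.rpow_neg h1.le]
      have : (1 + y) ^ (s - 1) = (1 + y) ^ (-((2:ℕ):ℝ)) * (1 + y) ^ (-(s - 1)) *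
          (1 + y) ^ (- -(2 * s)) := by
        rw [← Real.rpow_add h1, ← Real.rpow_add h1]; congr 1; push_cast; ring
      rw [this]; ring
    · intro y hy
      have hy' : δ < y := hy
      have h1 : 1 + y ≠ 0 := by linarith
      have := ((hasDerivAt_id y).div ((hasDerivAt_id y).const_add 1) h1)
      refine (this.congr_deriv ?_).hasDerivWithinAt
      simp only [id]
      congr 1
      ring
    · intro x hx y hy hxy
      have hx' : δ < x := hx
      have hy' : δ < y := hy
      have h1 : 1 + x ≠ 0 := by linarith
      have h2 : 1 + y ≠ 0 := by linarith
      simp only at hxy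
      field_simp at hxy
      linarith
  -- integrability pieces
  have hinteg := hh_integrable_one hs0 hs1
  have hI : IntegrableOn (hh s 1) (Ioi δ) := hinteg.mono_set (Ioi_subset_Ioi hδ.le)
  have hgI : ∀ p q : ℝ, 0 < p → p ≤ q → IntervalIntegrable g volume p q := by
    intro p q hp hpq
    refine IntervalIntegrable.mul_continuousOn ?_ ?_
    · have := (ee_intervalIntegrable hs0 (1 - p) (1 - q)).comp_sub_left 1
      simpa using this
    · intro y hy
      rw [uIcc_of_le hpq] at hy
      exact (Real.continuousAt_rpow_const _ _ (Or.inl (by linarith [hy.1]))).continuousWithinAt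
  have hg1 : ∀ r : ℝ, 1 ≤ r → g r = 0 := by
    intro r hr; simp only [hg]; rw [ee_of_nonpos (by linarith), zero_mul]
  have hgIoi : ∀ p : ℝ, 0 < p → p ≤ 1 → IntegrableOn g (Ioi p) := by
    intro p hp hp1
    rw [← Ioc_union_Ioi_eq_Ioi hp1]
    refine IntegrableOn.union ?_ ?_
    · rw [← intervalIntegrable_iff_integrableOn_Ioc_of_le hp1]; exact hgI p 1 hp hp1
    · refine IntegrableOn.congr_fun (f := fun _ => (0:ℝ)) ?_ ?_ measurableSet_Ioi
      · exact integrableOn_zero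
      · intro r hr; exact (hg1 r (le_of_lt hr)).symm
  have hgval : ∀ p : ℝ, 0 < p → p ≤ 1 → ∫ r in Ioi p, g r = ∫ r in p..1, g r := by
    intro p hp hp1
    rw [intervalIntegral.integral_of_le hp1, ← Ioc_union_Ioi_eq_Ioi hp1,
      setIntegral_union (Ioc_disjoint_Ioi le_rfl) measurableSet_Ioi
      ((hgIoi p hp hp1).mono_set Ioc_subset_Ioi_self) ((hgIoi p hp hp1).mono_set (Ioi_subset_Ioi hp1))]
    rw [setIntegral_congr_fun (g := fun _ => (0:ℝ)) measurableSet_Ioi 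
      (fun r hr => hg1 r (le_of_lt hr))]
    simp
  have hplus : IntegrableOn (fun y => ee s (1 + y) * y ^ (-(2 * s))) (Ioi δ) := by
    have := hI.add (hgIoi δ hδ (by linarith))
    refine this.congr (Filter.Eventually.of_forall fun y => ?_)
    simp only [Pi.add_apply, hh, hg]; ring
  have : ∫ y in Ioi δ, hh s 1 y = (∫ y in Ioi δ, ee s (1 + y) * y ^ (-(2 * s))) - ∫ y in Ioi δ, g y := by
    rw [← integral_sub hplus (hgIoi δ hδ (by linarith))]
    refine integral_congr_ae (Filter.Eventually.of_forall fun y => ?_)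
    simp only [hh, hg]; ring
  rw [this, ← hsub, hgval δ hδ (by linarith), ← integral_Ioc_eq_integral_Ioo,
    ← intervalIntegral.integral_of_le (by linarith),
    ← intervalIntegral.integral_add_adjacent_intervals (hgI _ _ hδ' hlt)
      (hgI δ 1 hδ (by linarith)), add_sub_cancel_right]
  refine intervalIntegral.integral_congr fun r hr => ?_
  rw [uIcc_of_le hlt] at hr
  simp only [hg]
  rw [ee_of_pos (by linarith [hr.2])]

lemma hh_integral_one {s : ℝ} (hs0 : 0 < s) (hs1 : s < 1) : ∫ y in Ioi 0, hh s 1 y = 0 := by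
  have hinteg := hh_integrable_one hs0 hs1
  set δ : ℕ → ℝ := fun k => 1 / ((k:ℝ) + 2) with hδ
  have hδ0 : ∀ k, 0 < δ k := fun k => by simp only [hδ]; positivity
  have hδ1 : ∀ k, δ k ≤ 1 / 2 := fun k => by
    simp only [hδ]
    apply one_div_le_one_div_of_le (by norm_num)
    have : (0:ℝ) ≤ k := Nat.cast_nonneg k
    linarith
  have hlim : Filter.Tendsto δ Filter.atTop (nhds 0) := by
    have := (tendsto_one_div_add_atTop_nhds_zero_nat (𝕜 := ℝ)).comp (Filter.tendsto_add_atTop_nat 1)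
    refine this.congr fun k => ?_
    simp only [hδ, Function.comp]; push_cast; ring
  have h1 : Filter.Tendsto (fun k => ∫ y in Ioi (δ k), hh s 1 y) Filter.atTop
      (nhds (∫ y in Ioi 0, hh s 1 y)) := by
    have := (aecover_Ioi_of_Ioi (μ := volume) hlim).integral_tendsto_of_countably_generated hinteg
    refine this.congr fun k => ?_
    rw [Measure.restrict_restrict measurableSet_Ioi,
      inter_eq_left.2 (Ioi_subset_Ioi (hδ0 k).le)]
  have h2 : Filter.Tendsto (fun k => ∫ y in Ioi (δ k), hh s 1 y) Filter.atTop (nhds 0) := by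
    have hb : ∀ k, ‖∫ y in Ioi (δ k), hh s 1 y‖ ≤ 2 * 4 * (δ k) ^ (2 - 2 * s) := by
      intro k
      have d0 := hδ0 k
      have d1 := hδ1 k
      rw [hh_trunc hs0 hs1 d0 d1]
      have hlt : δ k / (1 + δ k) ≤ δ k := by
        rw [div_le_iff₀ (by linarith)]; nlinarith
      have hge : δ k / 2 ≤ δ k / (1 + δ k) := by
        apply div_le_div_of_nonneg_left d0.le (by linarith) (by linarith)
      have := intervalIntegral.norm_integral_le_of_norm_le_const (a := δ k / (1 + δ k)) (b := δ k)
        (f := fun r => (1 - r) ^ (s - 1) * r ^ (-(2 * s))) (C := 2 * (4 * (δ k) ^ (-(2 * s)))) ?_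
      · refine this.trans ?_
        have h3 : |δ k - δ k / (1 + δ k)| ≤ (δ k) ^ 2 := by
          rw [abs_of_nonneg (by linarith)]
          have : δ k - δ k / (1 + δ k) = (δ k) ^ 2 / (1 + δ k) := by field_simp; ring
          rw [this]
          exact div_le_self (by positivity) (by linarith)
        calc 2 * (4 * (δ k) ^ (-(2 * s))) * |δ k - δ k / (1 + δ k)|
            ≤ 2 * (4 * (δ k) ^ (-(2 * s))) * (δ k) ^ 2 := by gcongr
          _ = 2 * 4 * (δ k) ^ (2 - 2 * s) := by
              rw [sub_eq_add_neg, Real.rpow_add d0, ← Real.rpow_natCast (δ k) 2]; push_cast; ring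
      · intro r hr
        rw [uIoc_of_le hlt] at hr
        have r0 : 0 < r := by linarith [hr.1]
        have r1 : r ≤ 1 / 2 := by linarith [hr.2]
        rw [norm_mul, Real.norm_eq_abs, Real.norm_eq_abs, abs_of_nonneg (Real.rpow_nonneg r0.le _),
          abs_of_nonneg (Real.rpow_nonneg (by linarith) _)]
        have a1 : (1 - r) ^ (s - 1) ≤ 2 := by
          calc (1 - r) ^ (s - 1) ≤ (1/2 : ℝ) ^ (s - 1) :=
                Real.rpow_le_rpow_of_nonpos (by norm_num) (by linarith) (by linarith)
            _ ≤ (1/2 : ℝ) ^ (-1 : ℝ) :=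
                Real.rpow_le_rpow_of_exponent_ge (by norm_num) (by norm_num) (by linarith)
            _ = 2 := by rw [Real.rpow_neg_one]; norm_num
        have a2 : r ^ (-(2 * s)) ≤ 4 * (δ k) ^ (-(2 * s)) := by
          calc r ^ (-(2 * s)) ≤ (1/2 * δ k) ^ (-(2 * s)) :=
                Real.rpow_le_rpow_of_nonpos (by positivity) (by linarith [hr.1]) (by linarith)
            _ = (1/2 : ℝ) ^ (-(2 * s)) * (δ k) ^ (-(2 * s)) :=
                Real.mul_rpow (by norm_num) d0.le
            _ ≤ (1/2 : ℝ) ^ (-2 : ℝ) * (δ k) ^ (-(2 * s)) := by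
                apply mul_le_mul_of_nonneg_right _ (Real.rpow_nonneg d0.le _)
                exact Real.rpow_le_rpow_of_exponent_ge (by norm_num) (by norm_num) (by linarith)
            _ = _ := by
                congr 1
                rw [show (-2:ℝ) = ((-2:ℤ):ℝ) by norm_num, Real.rpow_intCast]; norm_num
        exact mul_le_mul a1 a2 (Real.rpow_nonneg r0.le _) (by norm_num)
    refine squeeze_zero_norm hb ?_
    have := (hlim.rpow_const (p := 2 - 2 * s) (Or.inr (by linarith))).const_mul (2 * 4)
    rwa [Real.zero_rpow (by linarith), mul_zero] at this
  exact tendsto_nhds_unique h1 h2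

lemma hh_integrable {s : ℝ} (hs0 : 0 < s) (hs1 : s < 1) {a : ℝ} (ha : 0 < a) :
    IntegrableOn (hh s a) (Ioi 0) := by
  have := (integrableOn_Ioi_comp_mul_left_iff (hh s a) 0 ha)
  rw [mul_zero] at this
  rw [← this]
  refine IntegrableOn.congr_fun ((hh_integrable_one hs0 hs1).const_mul (a ^ (-1 - s))) ?_
    measurableSet_Ioi
  intro y hy
  exact (hh_scale s ha hy).symm

lemma hh_integral {s : ℝ} (hs0 : 0 < s) (hs1 : s < 1) {a : ℝ} (ha : 0 < a) :
    ∫ y in Ioi 0, hh s a y = 0 := by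
  have := integral_comp_mul_left_Ioi (hh s a) 0 ha
  rw [mul_zero, setIntegral_congr_fun measurableSet_Ioi (fun y hy => hh_scale s ha hy),
    integral_const_mul, hh_integral_one hs0 hs1, mul_zero] at this
  have h2 := this.symm
  rw [smul_eq_mul] at h2
  rcases mul_eq_zero.1 h2 with h | h
  · exact absurd h (inv_ne_zero ha.ne')
  · exact h

lemma hh_integral_abs {s : ℝ} {a : ℝ} (ha : 0 < a) :
    ∫ y in Ioi 0, ‖hh s a y‖ = a ^ (- s) * ∫ y in Ioi 0, ‖hh s 1 y‖ := by
  have := integral_comp_mul_left_Ioi (fun y => ‖hh s a y‖) 0 ha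
  rw [mul_zero, setIntegral_congr_fun (g := fun y => a ^ (-1 - s) * ‖hh s 1 y‖) measurableSet_Ioi
    (fun y hy => by
      simp only [hh_scale s ha hy, norm_mul, Real.norm_of_nonneg (Real.rpow_nonneg ha.le _)]),
    integral_const_mul, smul_eq_mul] at this
  have h2 : a ^ (-s) = a * a ^ (-1 - s) := by
    rw [show -s = 1 + (-1 - s) by ring, Real.rpow_add ha, Real.rpow_one]
  rw [h2, mul_assoc, this, ← mul_assoc, mul_inv_cancel₀ ha.ne', one_mul]

lemma pp_diff_eq {s : ℝ} (hs0 : 0 < s) (a y : ℝ) :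
    ∫ r in (0:ℝ)..y, s * (ee s (a + r) - ee s (a - r)) = pp s (a + y) + pp s (a - y) - 2 * pp s a := by
  have i1 : IntervalIntegrable (fun r => s * ee s (a + r)) volume 0 y := by
    have := ((ee_intervalIntegrable hs0 (a + 0) (a + y)).comp_add_left a).const_mul s
    simpa using this
  have i2 : IntervalIntegrable (fun r => s * ee s (a - r)) volume 0 y := by
    have := ((ee_intervalIntegrable hs0 (a - 0) (a - y)).comp_sub_left a).const_mul s
    simpa using this
  have : ∀ r, s * (ee s (a + r) - ee s (a - r)) = s * ee s (a + r) - s * ee s (a - r) :=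
    fun r => by ring
  simp_rw [this]
  rw [intervalIntegral.integral_sub i1 i2,
    intervalIntegral.integral_comp_add_left (fun z => s * ee s z) a,
    intervalIntegral.integral_comp_sub_left (fun z => s * ee s z) a, ee_integral hs0,
    ee_integral hs0]
  simp only [add_zero, sub_zero]
  ring

lemma oneD_F1 {s : ℝ} (hs0 : 0 < s) (hs1 : s < 1) {a : ℝ} (ha : 0 < a) :
    ∫ y in Ioi (0:ℝ), (pp s (a + y) + pp s (a - y) - 2 * pp s a) * y ^ (-1 - 2 * s) = 0 := by
  set D : ℝ → ℝ := fun r => s * (ee s (a + r) - ee s (a - r)) with hD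
  have hDm : Measurable D := by
    have := ee_meas s
    simp only [hD]; fun_prop
  set f : ℝ → ℝ → ℝ := fun r y => (Ioi r).indicator (fun y => D r * y ^ (-1 - 2 * s)) y with hf
  have hfm : Measurable (Function.uncurry f) := by
    have : Function.uncurry f = {p : ℝ × ℝ | p.1 < p.2}.indicator
        (fun p => D p.1 * p.2 ^ (-1 - 2 * s)) := by
      ext p
      simp only [Function.uncurry, hf, indicator, mem_Ioi, mem_ofPred_eq]
    rw [this]
    exact Measurable.indicator (by fun_prop) (measurableSet_lt measurable_fst measurable_snd)
  have hpow : ∀ r : ℝ, 0 < r → ∫ y in Ioi r, y ^ (-1 - 2 * s) = r ^ (-(2 * s)) / (2 * s) := by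
    intro r hr
    rw [integral_Ioi_rpow_of_lt (by linarith) hr, show -1 - 2 * s + 1 = -(2 * s) by ring, neg_div_neg_eq]
  have hpowI : ∀ r : ℝ, 0 < r → IntegrableOn (fun y : ℝ => y ^ (-1 - 2 * s)) (Ioi r) := fun r hr =>
    integrableOn_Ioi_rpow_of_lt (by linarith) hr
  have hfr : ∀ r : ℝ, 0 < r → ∀ h : ℝ → ℝ, ∫ y in Ioi (0:ℝ), (Ioi r).indicator h y
      = ∫ y in Ioi r, h y := by
    intro r hr h
    rw [setIntegral_indicator measurableSet_Ioi, inter_eq_right.2 (Ioi_subset_Ioi hr.le)]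
  have hF : Integrable (Function.uncurry f)
      ((volume.restrict (Ioi (0:ℝ))).prod (volume.restrict (Ioi (0:ℝ)))) := by
    rw [integrable_prod_iff hfm.aestronglyMeasurable]
    constructor
    · refine (ae_restrict_iff' measurableSet_Ioi).2 (Filter.Eventually.of_forall fun r hr => ?_)
      simp only [Function.uncurry, hf]
      rw [integrable_indicator_iff measurableSet_Ioi, IntegrableOn,
        Measure.restrict_restrict measurableSet_Ioi, inter_eq_left.2 (Ioi_subset_Ioi (le_of_lt hr))]
      exact (hpowI r hr).const_mul _
    · have h1 := ((hh_integrable hs0 hs1 ha).norm).const_mul (1/2)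
      refine h1.congr ((ae_restrict_iff' measurableSet_Ioi).2
        (Filter.Eventually.of_forall fun r hr => ?_))
      have hr0 : (0:ℝ) < r := hr
      simp only [Function.uncurry, hf]
      simp_rw [norm_indicator_eq_indicator_norm]
      rw [hfr r hr0, setIntegral_congr_fun (g := fun y => ‖D r‖ * y ^ (-1 - 2 * s)) measurableSet_Ioi,
        integral_const_mul, hpow r hr0]
      · simp only [hD, hh, norm_mul, Real.norm_of_nonneg hs0.le,
          Real.norm_of_nonneg (Real.rpow_nonneg hr0.le _)]
        field_simp
      · intro y hy
        have : (0:ℝ) < y := lt_trans hr0 hy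
        simp only [norm_mul, Real.norm_of_nonneg (Real.rpow_nonneg this.le _)]
  have hswap := integral_integral_swap hF
  have hL : ∫ r in Ioi (0:ℝ), ∫ y in Ioi (0:ℝ), f r y = 0 := by
    rw [setIntegral_congr_fun (g := fun r => (1/2) * hh s a r) measurableSet_Ioi,
      integral_const_mul, hh_integral hs0 hs1 ha, mul_zero]
    intro r hr
    have hr0 : (0:ℝ) < r := hr
    simp only [hf]
    rw [hfr r hr0, integral_const_mul, hpow r hr0]
    simp only [hD, hh]
    field_simp
  rw [hL] at hswap
  refine Eq.trans ?_ hswap.symm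
  refine setIntegral_congr_fun measurableSet_Ioi fun y hy => ?_
  have hy0 : (0:ℝ) < y := hy
  have : ∀ r, f r y = (Iio y).indicator (fun r => D r * y ^ (-1 - 2 * s)) r := by
    intro r; simp only [hf, indicator, mem_Ioi, mem_Iio]
  simp only [this]
  rw [setIntegral_indicator measurableSet_Iio, Ioi_inter_Iio, ← integral_Ioc_eq_integral_Ioo,
    ← intervalIntegral.integral_of_le hy0.le, intervalIntegral.integral_mul_const, pp_diff_eq hs0]

/-- the difference `(z+t)_+^s - z_+^s` -/
noncomputable def ft (s t z : ℝ) : ℝ := pp s (z + t) - pp s z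

lemma oneD_F2 {s : ℝ} (hs0 : 0 < s) (hs1 : s < 1) {a t : ℝ} (ha : 0 < a) (ht : 0 < t) :
    ∫ y in Ioi (0:ℝ), (ft s t (a + y) - ft s t (a - y)) * y ^ (-(2 * s)) = 0 := by
  set f : ℝ → ℝ → ℝ := fun τ y => s * hh s (a + τ) y with hf
  have hfm : Measurable (Function.uncurry f) := by
    have := ee_meas s
    simp only [hf, Function.uncurry_def, hh]
    fun_prop
  have hF : Integrable (Function.uncurry f)
      ((volume.restrict (Ioc (0:ℝ) t)).prod (volume.restrict (Ioi (0:ℝ)))) := by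
    rw [integrable_prod_iff hfm.aestronglyMeasurable]
    constructor
    · refine (ae_restrict_iff' measurableSet_Ioc).2 (Filter.Eventually.of_forall fun τ hτ => ?_)
      simp only [Function.uncurry, hf]
      exact (hh_integrable hs0 hs1 (by linarith [hτ.1])).const_mul s
    · have h1 : IntegrableOn (fun τ => s * ((a + τ) ^ (-s) * ∫ y in Ioi 0, ‖hh s 1 y‖)) (Ioc 0 t) := by
        refine IntegrableOn.mono_set (t := Icc 0 t) ?_ Ioc_subset_Icc_self
        refine ContinuousOn.integrableOn_Icc ?_
        refine continuousOn_const.mul (ContinuousOn.mul ?_ continuousOn_const)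
        refine ContinuousOn.rpow_const (by fun_prop) fun τ hτ => Or.inl ?_
        linarith [hτ.1]
      refine Integrable.congr h1 ((ae_restrict_iff' measurableSet_Ioc).2
        (Filter.Eventually.of_forall fun τ hτ => ?_))
      simp only [Function.uncurry, hf, norm_mul, Real.norm_of_nonneg hs0.le]
      rw [integral_const_mul, hh_integral_abs (a := a + τ) (by linarith [hτ.1])]
  have hswap := integral_integral_swap hF
  have hL : ∫ τ in Ioc (0:ℝ) t, ∫ y in Ioi (0:ℝ), f τ y = 0 := by
    rw [setIntegral_congr_fun (g := fun _ => (0:ℝ)) measurableSet_Ioc]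
    · simp
    · intro τ hτ
      simp only [hf]
      rw [integral_const_mul, hh_integral hs0 hs1 (by linarith [hτ.1]), mul_zero]
  rw [hL] at hswap
  refine Eq.trans ?_ hswap.symm
  refine setIntegral_congr_fun measurableSet_Ioi fun y hy => ?_
  simp only [hf, hh]
  rw [← intervalIntegral.integral_of_le ht.le]
  have i1 : IntervalIntegrable (fun τ => s * ee s ((a + y) + τ)) volume 0 t := by
    have := ((ee_intervalIntegrable hs0 (a + y + 0) (a + y + t)).comp_add_left (a + y)).const_mul s
    simpa using this
  have i2 : IntervalIntegrable (fun τ => s * ee s ((a - y) + τ)) volume 0 t := by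
    have := ((ee_intervalIntegrable hs0 (a - y + 0) (a - y + t)).comp_add_left (a - y)).const_mul s
    simpa using this
  have : ∀ τ, s * ((ee s (a + τ + y) - ee s (a + τ - y)) * y ^ (-(2 * s)))
      = (s * ee s ((a + y) + τ) - s * ee s ((a - y) + τ)) * y ^ (-(2 * s)) := by
    intro τ
    rw [show a + τ + y = a + y + τ by ring, show a + τ - y = a - y + τ by ring]; ring
  simp_rw [this]
  rw [intervalIntegral.integral_mul_const, intervalIntegral.integral_sub i1 i2,
    intervalIntegral.integral_comp_add_left (fun z => s * ee s z) (a + y),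
    intervalIntegral.integral_comp_add_left (fun z => s * ee s z) (a - y), ee_integral hs0,
    ee_integral hs0]
  simp only [add_zero, ft]

lemma ray_scale (F : ℝ → ℝ) (p : ℝ) (h : ∫ y in Ioi (0:ℝ), F y * y ^ p = 0) {c : ℝ} (hc : 0 < c) :
    ∫ r in Ioi (0:ℝ), F (c * r) * r ^ p = 0 := by
  have := integral_comp_mul_left_Ioi (fun y => F y * y ^ p) 0 hc
  rw [mul_zero, h, smul_zero] at this
  rw [setIntegral_congr_fun (g := fun r => c ^ p * (F (c * r) * r ^ p)) measurableSet_Ioi,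
    integral_const_mul] at this
  · exact (mul_eq_zero.1 this).resolve_left (Real.rpow_pos_of_pos hc p).ne'
  · intro r hr
    have : (0:ℝ) < r := hr
    simp only [Real.mul_rpow hc.le this.le]
    ring

/-- Ambient space. -/
abbrev EE (d : ℕ) := EuclideanSpace ℝ (Fin (d+1))

/-- Polar coordinates: if every ray integral vanishes, so does the integral. -/
lemma polar0 (d : ℕ) (F : EE d → ℝ)
    (h : ∀ θ : EE d, ‖θ‖ = 1 → ∫ r in Ioi (0:ℝ), F (r • θ) * r ^ d = 0) :
    ∫ y, F y = 0 := by
  have hmp := (volume : Measure (EE d)).measurePreserving_homeomorphUnitSphereProd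
  have e1 : ∫ y, F y = ∫ y : ({0}ᶜ : Set (EE d)), F y ∂(Measure.comap (↑) (volume : Measure (EE d))) := by
    rw [integral_subtype_comap (MeasurableSet.compl (measurableSet_singleton 0)),
      restrict_compl_singleton]
  have e2 := hmp.integral_comp (Homeomorph.measurableEmbedding _)
    (fun p => F (((homeomorphUnitSphereProd (EE d)).symm p : ({0}ᶜ : Set (EE d))) : EE d))
  simp only [Homeomorph.symm_apply_apply] at e2
  rw [e1, e2]
  by_cases hi : Integrable (fun p => F (((homeomorphUnitSphereProd (EE d)).symm p : ({0}ᶜ : Set (EE d))) : EE d))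
      ((volume : Measure (EE d)).toSphere.prod (Measure.volumeIoiPow (Module.finrank ℝ (EE d) - 1)))
  · rw [integral_prod _ hi]
    have : ∀ θ : sphere (0:EE d) 1, ∫ r, F (((homeomorphUnitSphereProd (EE d)).symm (θ, r) : ({0}ᶜ : Set (EE d))) : EE d)
        ∂(Measure.volumeIoiPow (Module.finrank ℝ (EE d) - 1)) = 0 := by
      intro θ
      have hfr : Module.finrank ℝ (EE d) - 1 = d := by simp
      rw [hfr, Measure.volumeIoiPow, integral_withDensity_eq_integral_toReal_smul (by fun_prop) (by simp)]
      have := h θ (by simp)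
      rw [← integral_subtype_comap measurableSet_Ioi] at this
      refine Eq.trans ?_ this
      congr 1; ext r
      have hr : (0:ℝ) < r := r.2
      rw [ENNReal.toReal_ofReal (by positivity)]
      simp [homeomorphUnitSphereProd, homeomorphSphereProd, mul_comm]
    simp only [this, integral_zero]
  · exact integral_undef hi

/-- Radial integrability near and far. -/
lemma rad_near (d : ℕ) {p : ℝ} (hp : -((d:ℝ)+1) < p) (r0 : ℝ) (h0 : 0 < r0):
    Integrable (fun y : EE d => if ‖y‖ < r0 then ‖y‖ ^ p else 0) := by
  have := (integrable_fun_norm_addHaar (volume : Measure (EE d))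
    (f := fun r => if r < r0 then r ^ p else 0)).2
  apply this
  have h1 : IntegrableOn (fun r : ℝ => r ^ (p + d)) (Ioo 0 r0) := by
    rw [intervalIntegral.integrableOn_Ioo_rpow_iff h0]; linarith
  have h2 := h1.integrable_indicator measurableSet_Ioo
  refine h2.integrableOn.congr_fun ?_ measurableSet_Ioi
  intro y hy
  have hy' : 0 < y := hy
  by_cases hyr : y < r0
  · simp only [indicator, mem_Ioo, hy', hyr, and_self, if_true]
    simp [Real.rpow_add hy', mul_comm]
  · simp [hyr]

lemma rad_far (d : ℕ) {p : ℝ} (hp : p < -((d:ℝ)+1)) (r0 : ℝ) (h0 : 0 < r0):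
    Integrable (fun y : EE d => if ‖y‖ < r0 then 0 else ‖y‖ ^ p) := by
  have := (integrable_fun_norm_addHaar (volume : Measure (EE d))
    (f := fun r => if r < r0 then 0 else r ^ p)).2
  apply this
  have h1 : IntegrableOn (fun r : ℝ => r ^ (p + d)) (Ici r0) := by
    rw [integrableOn_Ici_iff_integrableOn_Ioi]
    apply integrableOn_Ioi_rpow_of_lt (by linarith) h0
  have h2 := h1.integrable_indicator measurableSet_Ici
  refine h2.integrableOn.congr_fun ?_ measurableSet_Ioi
  intro y hy
  have hy' : 0 < y := hy
  by_cases hyr : y < r0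
  · simp [hyr]
  · have : r0 ≤ y := not_lt.1 hyr
    simp only [indicator, mem_Ici, this, hyr, if_true, if_false]
    simp [Real.rpow_add hy', mul_comm]

/-- One-dimensional weight used in the product bound. -/
noncomputable def gg (d : ℕ) (s : ℝ) (i : Fin (d+1)) (t : ℝ) : ℝ :=
  if i = Fin.last d then |t| ^ (s-1) * (1+|t|) ^ (-(3*s/2)) else (1+|t|) ^ (-(1+s/(2*(d+1))))

lemma gg_last_int {s : ℝ} (hs0 : 0 < s) :
    Integrable (fun t : ℝ => |t| ^ (s-1) * (1+|t|) ^ (-(3*s/2))) := by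
  have := (integrable_fun_norm_addHaar (volume : Measure ℝ)
    (f := fun r => |r| ^ (s-1) * (1+|r|) ^ (-(3*s/2)))).2
  simp only [Real.norm_eq_abs, abs_abs] at this
  apply this
  simp only [Module.finrank_self, Nat.sub_self, pow_zero, one_smul]
  rw [← Ioc_union_Ioi_eq_Ioi (zero_le_one (α := ℝ))]
  have hm : Measurable (fun t : ℝ => |t| ^ (s-1) * (1+|t|) ^ (-(3*s/2))) := by fun_prop
  apply IntegrableOn.union
  · have h1 : IntegrableOn (fun r : ℝ => r ^ (s-1)) (Ioc 0 1) := by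
      rw [integrableOn_Ioc_iff_integrableOn_Ioo,
        intervalIntegral.integrableOn_Ioo_rpow_iff zero_lt_one]; linarith
    refine h1.mono' hm.aestronglyMeasurable ?_
    filter_upwards [ae_restrict_mem measurableSet_Ioc] with y hy
    have hy0 := hy.1
    rw [Real.norm_eq_abs, abs_of_nonneg (by positivity), abs_of_pos hy0]
    have : (1+y) ^ (-(3*s/2)) ≤ 1 := Real.rpow_le_one_of_one_le_of_nonpos (by linarith) (by linarith)
    have h3 : 0 ≤ y ^ (s-1) := by positivity
    nlinarith
  · have h1 : IntegrableOn (fun r : ℝ => r ^ (-1-s/2)) (Ioi 1) :=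
      integrableOn_Ioi_rpow_of_lt (by linarith) one_pos
    refine h1.mono' hm.aestronglyMeasurable ?_
    filter_upwards [ae_restrict_mem measurableSet_Ioi] with y hy
    have hy1 : 1 < y := hy
    have hy0 : 0 < y := by linarith
    rw [Real.norm_eq_abs, abs_of_nonneg (by positivity), abs_of_pos hy0]
    have : (1+y) ^ (-(3*s/2)) ≤ y ^ (-(3*s/2)) :=
      Real.rpow_le_rpow_of_nonpos hy0 (by linarith) (by linarith)
    calc _ ≤ y ^ (s-1) * y ^ (-(3*s/2)) := by gcongr
      _ = _ := by rw [← Real.rpow_add hy0]; congr 1; ring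

lemma gg_int {s : ℝ} (hs0 : 0 < s) (d : ℕ) (i : Fin (d+1)) : Integrable (gg d s i) := by
  by_cases h : i = Fin.last d
  · unfold gg; simp only [h, if_true]; exact gg_last_int hs0
  · unfold gg; simp only [h, if_false]
    have := integrable_one_add_norm (E := ℝ) (μ := volume) (r := 1+s/(2*(d+1))) (by
      simp; positivity)
    simpa using this

lemma coord_le_norm {d : ℕ} (y : EE d) (i : Fin (d+1)) : |y i| ≤ ‖y‖ := by
  simpa using PiLp.norm_apply_le y i

lemma J_int {s : ℝ} (hs0 : 0 < s) (d : ℕ) :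
    Integrable (fun y : EE d => if ‖y‖ < 1 then 0 else |y (Fin.last d)| ^ (s-1) * ‖y‖ ^ (-(d + 2*s))) := by
  have h1 : Integrable (fun x : Fin (d+1) → ℝ => ∏ i, gg d s i (x i)) :=
    Integrable.fintype_prod (fun i => gg_int hs0 d i)
  have h2 : Integrable (fun y : EE d => ∏ i, gg d s i (y i)) := by
    have := (PiLp.volume_preserving_ofLp (Fin (d+1))).integrable_comp_emb
      (MeasurableEquiv.toLp 2 (Fin (d+1) → ℝ)).symm.measurableEmbedding (g := fun x => ∏ i, gg d s i (x i))
    exact this.2 h1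
  refine (h2.const_mul (2 ^ ((d:ℝ) + 2*s))).mono' ?_ ?_
  · refine (Measurable.ite (measurableSet_lt (by fun_prop) (by fun_prop)) (by fun_prop) ?_).aestronglyMeasurable
    fun_prop
  · refine Filter.Eventually.of_forall fun y => ?_
    have hgn : ∀ i, 0 ≤ gg d s i (y i) := by intro i; unfold gg; split_ifs <;> positivity
    split_ifs with hy
    · simp only [norm_zero]
      have := Finset.prod_nonneg (fun i (_ : i ∈ Finset.univ) => hgn i); positivity
    · have hy1 : 1 ≤ ‖y‖ := not_lt.1 hy
      have hY : 0 < ‖y‖ := by linarith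
      rw [Real.norm_eq_abs, abs_of_nonneg (by positivity)]
      have hb : ∀ i, ∀ q : ℝ, 0 ≤ q → (2*‖y‖) ^ (-q) ≤ (1 + |y i|) ^ (-q) := by
        intro i q hq
        apply Real.rpow_le_rpow_of_nonpos (by positivity) _ (by linarith)
        have := coord_le_norm y i; linarith
      rw [Fin.prod_univ_castSucc]
      have hne : ∀ i : Fin d, ¬ (i.castSucc = Fin.last d) := fun i => (Fin.castSucc_lt_last i).ne
      have hq : (0:ℝ) ≤ 1+s/(2*(d+1)) := by positivity
      have hprod : ((2*‖y‖) ^ (-(1+s/(2*(d+1))))) ^ d ≤ ∏ i : Fin d, gg d s i.castSucc (y i.castSucc) := by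
        calc _ = ∏ i : Fin d, ((2*‖y‖) ^ (-(1+s/(2*(d+1))))) := by simp
          _ ≤ _ := by
            apply Finset.prod_le_prod
            · intros; positivity
            · intro i _; unfold gg; simp only [hne, if_false]; exact hb _ _ hq
      have hlast : |y (Fin.last d)| ^ (s-1) * (2*‖y‖) ^ (-(3*s/2)) ≤ gg d s (Fin.last d) (y (Fin.last d)) := by
        unfold gg; simp only [if_true]
        exact mul_le_mul_of_nonneg_left (hb _ _ (by positivity)) (by positivity)
      have hkey : ‖y‖ ^ (-(d + 2*s)) ≤ 2 ^ ((d:ℝ) + 2*s) * (((2*‖y‖) ^ (-(1+s/(2*(d+1))))) ^ d * (2*‖y‖) ^ (-(3*s/2))) := by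
        have e1 : ‖y‖ ^ (-(d + 2*s)) = 2 ^ ((d:ℝ) + 2*s) * (2*‖y‖) ^ (-(d + 2*s)) := by
          rw [Real.mul_rpow (by norm_num) hY.le, ← mul_assoc, ← Real.rpow_add (by norm_num)]; simp
        rw [e1]; gcongr
        rw [← Real.rpow_natCast, ← Real.rpow_mul (by positivity), ← Real.rpow_add (by positivity)]
        apply Real.rpow_le_rpow_of_exponent_le (by linarith)
        have : s/(2*((d:ℝ)+1)) * d ≤ s/2 := by
          rw [div_mul_eq_mul_div, div_le_div_iff₀ (by positivity) (by positivity)]; nlinarith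
        nlinarith
      calc _ ≤ |y (Fin.last d)| ^ (s-1) * (2 ^ ((d:ℝ) + 2*s) * (((2*‖y‖) ^ (-(1+s/(2*(d+1))))) ^ d * (2*‖y‖) ^ (-(3*s/2)))) := by gcongr
        _ = 2 ^ ((d:ℝ) + 2*s) * (((2*‖y‖) ^ (-(1+s/(2*(d+1))))) ^ d * (|y (Fin.last d)| ^ (s-1) * (2*‖y‖) ^ (-(3*s/2)))) := by ring
        _ ≤ _ := by
          gcongr
          exact Finset.prod_nonneg fun i _ => hgn _

/-- Symmetric second difference. -/
noncomputable def sd {d : ℕ} (u : EE d → ℝ) (x y : EE d) : ℝ := (u (x + y) + u (x - y)) / 2 - u x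

/-- The integrand of `kerOp`. -/
noncomputable def kint (d : ℕ) (s : ℝ) (μ u : EE d → ℝ) (x y : EE d) : ℝ :=
  sd u x y * μ (‖y‖⁻¹ • y) / ‖y‖ ^ (((d + 1 : ℕ) : ℝ) + 2 * s)

lemma kerOp_eq (d : ℕ) (s : ℝ) (μ u : EE d → ℝ) (x : EE d) :
    kerOp (d+1) s μ u x = (1 - s) * ∫ y, kint d s μ u x y := rfl

/-- Dominating function. -/
noncomputable def dom (d : ℕ) (s A p B q r : ℝ) (y : EE d) : ℝ :=
  A * (if ‖y‖ < r then ‖y‖ ^ (p - ((d:ℝ)+1+2*s)) else 0) +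
  B * (if ‖y‖ < r then 0 else ‖y‖ ^ (q - ((d:ℝ)+1+2*s)))

lemma dom_int (d : ℕ) {s p q r : ℝ} (A B : ℝ) (hp : 2 * s < p) (hq : q < 2 * s) (hr : 0 < r) :
    Integrable (dom d s A p B q r) :=
  ((rad_near d (by linarith) r hr).const_mul A).add ((rad_far d (by linarith) r hr).const_mul B)

lemma spec_abs {d : ℕ} {lam Lam : ℝ} {μ : EE d → ℝ} (hlam : 0 < lam) (hμ : SpecOK (d+1) lam Lam μ)
    {y : EE d} (hy : y ≠ 0) :
    lam ≤ μ (‖y‖⁻¹ • y) ∧ μ (‖y‖⁻¹ • y) ≤ Lam ∧ |μ (‖y‖⁻¹ • y)| ≤ Lam := by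
  have h := hμ.2 (‖y‖⁻¹ • y) (by simp [norm_smul, hy])
  refine ⟨h.2.1, h.2.2, ?_⟩
  rw [abs_of_pos (by linarith)]; exact h.2.2

lemma kint_zero (d : ℕ) {s : ℝ} (hs0 : 0 < s) (μ u : EE d → ℝ) (x : EE d) : kint d s μ u x 0 = 0 := by
  unfold kint; rw [norm_zero, Real.zero_rpow (by positivity)]; simp

lemma kint_le {d : ℕ} {s lam Lam : ℝ} (hs0 : 0 < s) (hlam : 0 < lam) {μ : EE d → ℝ}
    (hμ : SpecOK (d+1) lam Lam μ) (u : EE d → ℝ) (x y : EE d) :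
    |kint d s μ u x y| ≤ Lam * (|sd u x y| * ‖y‖ ^ (-((d:ℝ)+1+2*s))) := by
  by_cases hy : y = 0
  · subst hy; rw [kint_zero d hs0, norm_zero, Real.zero_rpow (by
      have := Nat.cast_nonneg (α := ℝ) d
      intro h; linarith)]
    simp
  · have h := spec_abs hlam hμ hy
    have hY : 0 < ‖y‖ := norm_pos_iff.2 hy
    unfold kint
    rw [abs_div, abs_mul, Real.rpow_neg hY.le, abs_of_nonneg (a := ‖y‖ ^ _) (by positivity)]
    push_cast
    rw [div_eq_mul_inv]
    have : |sd u x y| * |μ (‖y‖⁻¹ • y)| ≤ |sd u x y| * Lam := by gcongr; exact h.2.2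
    calc _ ≤ |sd u x y| * Lam * (‖y‖ ^ ((d:ℝ)+1+2*s))⁻¹ := by gcongr
      _ = _ := by ring

lemma kint_dom {d : ℕ} {s lam Lam : ℝ} (hs0 : 0 < s) (hlam : 0 < lam) (hlL : lam ≤ Lam) {μ : EE d → ℝ}
    (hμ : SpecOK (d+1) lam Lam μ) {u : EE d → ℝ} {x : EE d} {A p B q r : ℝ} (hr : 0 < r) (hA : 0 ≤ A)
    (h1 : ∀ y, ‖y‖ < r → |sd u x y| ≤ A * ‖y‖ ^ p) (h2 : ∀ y, r ≤ ‖y‖ → |sd u x y| ≤ B * ‖y‖ ^ q)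
    (y : EE d) : |kint d s μ u x y| ≤ Lam * dom d s A p B q r y := by
  have hL : 0 < Lam := by linarith
  by_cases hy : y = 0
  · subst hy; rw [kint_zero d hs0]; simp [dom, hr]
    positivity
  have hY : 0 < ‖y‖ := norm_pos_iff.2 hy
  refine (kint_le hs0 hlam hμ u x y).trans ?_
  gcongr
  unfold dom
  split_ifs with h
  · calc _ ≤ (A * ‖y‖ ^ p) * ‖y‖ ^ (-((d:ℝ)+1+2*s)) := by gcongr; exact h1 y h
      _ = _ := by rw [mul_assoc, ← Real.rpow_add hY]; simp [sub_eq_add_neg]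
  · calc _ ≤ (B * ‖y‖ ^ q) * ‖y‖ ^ (-((d:ℝ)+1+2*s)) := by gcongr; exact h2 y (not_lt.1 h)
      _ = _ := by rw [mul_assoc, ← Real.rpow_add hY]; simp [sub_eq_add_neg]

lemma sd_meas {d : ℕ} {u : EE d → ℝ} (hu : Measurable u) (x : EE d) : Measurable (sd u x) := by
  unfold sd; fun_prop

lemma kint_meas {d : ℕ} {s : ℝ} {μ u : EE d → ℝ} (hμ : Measurable μ) (hu : Measurable u) (x : EE d) :
    Measurable (kint d s μ u x) := by
  have := sd_meas hu x
  unfold kint; fun_prop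

lemma kint_integrable {d : ℕ} {s lam Lam : ℝ} (hs0 : 0 < s) (hlam : 0 < lam) (hlL : lam ≤ Lam) {μ : EE d → ℝ}
    (hμ : SpecOK (d+1) lam Lam μ) {u : EE d → ℝ} (hu : Measurable u) {x : EE d} {A p B q r : ℝ} (hr : 0 < r)
    (hA : 0 ≤ A) (hp : 2 * s < p) (hq : q < 2 * s)
    (h1 : ∀ y, ‖y‖ < r → |sd u x y| ≤ A * ‖y‖ ^ p) (h2 : ∀ y, r ≤ ‖y‖ → |sd u x y| ≤ B * ‖y‖ ^ q) :
    Integrable (kint d s μ u x) :=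
  ((dom_int d A B hp hq hr).const_mul Lam).mono' (kint_meas hμ.1 hu x).aestronglyMeasurable
    (Filter.Eventually.of_forall fun y => kint_dom hs0 hlam hlL hμ hr hA h1 h2 y)

/-- Growth of order three halves of s plus quadratic second difference bound gives integrability. -/
lemma kint_integrable_growth {d : ℕ} {s lam Lam : ℝ} (hs0 : 0 < s) (hs1 : s < 1) (hlam : 0 < lam) (hlL : lam ≤ Lam)
    {μ : EE d → ℝ}
    (hμ : SpecOK (d+1) lam Lam μ) {u : EE d → ℝ} (hu : Measurable u) {x : EE d} {K A r : ℝ}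
    (hK : ∀ z, |u z| ≤ K * (1 + ‖z‖) ^ (3*s/2)) (hr : 0 < r) (hA : 0 ≤ A)
    (h1 : ∀ y, ‖y‖ < r → |sd u x y| ≤ A * ‖y‖ ^ (2:ℝ)) :
    Integrable (kint d s μ u x) := by
  have hK0 : 0 ≤ K := by
    have := (abs_nonneg _).trans (hK 0)
    simpa using this
  refine kint_integrable hs0 hlam hlL hμ hu (B := 2 * K * ((1 + ‖x‖)/r + 1) ^ (3*s/2)) hr hA
    (by linarith) (q := 3*s/2) (by linarith) h1 ?_
  intro y hy
  have hY : 0 < ‖y‖ := by linarith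
  have hb : ∀ z : EE d, ‖z‖ ≤ ‖x‖ + ‖y‖ → |u z| ≤ K * ((1 + ‖x‖)/r + 1) ^ (3*s/2) * ‖y‖ ^ (3*s/2) := by
    intro z hz
    refine (hK z).trans ?_
    rw [mul_assoc, ← Real.mul_rpow (by positivity) hY.le]
    gcongr
    have : (1 + ‖x‖) ≤ (1 + ‖x‖)/r * ‖y‖ := by
      rw [div_mul_eq_mul_div, le_div_iff₀ hr]; gcongr
    nlinarith
  have ha := hb (x+y) (norm_add_le _ _)
  have hb' := hb (x-y) (norm_sub_le _ _)
  have hc := hb x (by linarith)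
  unfold sd
  have e1 := abs_sub ((u (x + y) + u (x - y)) / 2) (u x)
  have e2 : |(u (x + y) + u (x - y)) / 2| ≤ (|u (x+y)| + |u (x-y)|)/2 := by
    rw [abs_div, abs_two]; gcongr; exact abs_add_le _ _
  have e3 : 2 * K * ((1 + ‖x‖)/r + 1) ^ (3*s/2) * ‖y‖ ^ (3*s/2) =
    2 * (K * ((1 + ‖x‖)/r + 1) ^ (3*s/2) * ‖y‖ ^ (3*s/2)) := by ring
  rw [e3]; linarith

lemma sd_le_of_fderiv {d : ℕ} {u : EE d → ℝ} {x y : EE d} {K : ℝ}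
    (hd : ∀ z ∈ closedBall x ‖y‖, DifferentiableAt ℝ u z)
    (hL : ∀ z ∈ closedBall x ‖y‖, ‖fderiv ℝ u z - fderiv ℝ u x‖ ≤ K * ‖z - x‖) (hK : 0 ≤ K) :
    |sd u x y| ≤ K * ‖y‖ ^ (2:ℝ) := by
  have hx : x ∈ closedBall x ‖y‖ := mem_closedBall_self (norm_nonneg _)
  have key : ∀ z ∈ closedBall x ‖y‖, ‖u z - u x - fderiv ℝ u x (z - x)‖ ≤ K * ‖y‖ * ‖z - x‖ := by
    intro z hz
    refine (convex_closedBall x ‖y‖).norm_image_sub_le_of_norm_fderiv_le' (𝕜 := ℝ) hd ?_ hx hz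
    intro w hw
    refine (hL w hw).trans ?_
    gcongr
    simpa [dist_eq_norm] using hw
  have h1 := key (x + y) (by simp)
  have h2 := key (x - y) (by simp [dist_eq_norm])
  have e1 : x + y - x = y := by abel
  have e2 : x - y - x = -y := by abel
  rw [e1, Real.norm_eq_abs] at h1
  rw [e2, Real.norm_eq_abs, map_neg, norm_neg] at h2
  have : sd u x y = ((u (x+y) - u x - fderiv ℝ u x y) + (u (x-y) - u x - -fderiv ℝ u x y))/2 := by
    unfold sd; ring
  rw [this, abs_div, abs_two, Real.rpow_two]
  have := abs_add_le (u (x+y) - u x - fderiv ℝ u x y) (u (x-y) - u x - -fderiv ℝ u x y)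
  rw [div_le_iff₀ two_pos]
  nlinarith

lemma sd_of_contDiffAt {d : ℕ} {u : EE d → ℝ} {x : EE d} (hu : ContDiffAt ℝ 2 u x) :
    ∃ r A : ℝ, 0 < r ∧ 0 ≤ A ∧ ∀ y, ‖y‖ < r → |sd u x y| ≤ A * ‖y‖ ^ (2:ℝ) := by
  have h1 : ContDiffAt ℝ 1 (fderiv ℝ u) x := hu.fderiv_right (by norm_num)
  obtain ⟨K, t, ht, hK⟩ := h1.exists_lipschitzOnWith
  have h2 : ∀ᶠ z in nhds x, DifferentiableAt ℝ u z :=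
    (hu.eventually (by simp)).mono fun z hz => hz.differentiableAt (by norm_num)
  obtain ⟨r, hr, hrt⟩ := Metric.mem_nhds_iff.1 (Filter.inter_mem ht h2)
  refine ⟨r, K, hr, K.2, fun y hy => ?_⟩
  have hsub : closedBall x ‖y‖ ⊆ ball x r := closedBall_subset_ball hy
  refine sd_le_of_fderiv (fun z hz => (hrt (hsub hz)).2) (fun z hz => ?_) K.2
  have := hK.dist_le_mul z (hrt (hsub hz)).1 x (hrt (mem_ball_self hr)).1
  simpa [dist_eq_norm] using this

/-- The upper half space. -/
abbrev HS (d : ℕ) : Set (EE d) := {x : EuclideanSpace ℝ (Fin (d + 1)) | 0 < x (Fin.last d)}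

lemma HS_open (d : ℕ) : IsOpen (HS d) :=
  isOpen_lt continuous_const (by fun_prop)

/-- Classical solutions for every kernel of the class. -/
structure NullSol (d : ℕ) (s lam Lam : ℝ) (Φ : EE d → ℝ) : Prop where
  c2 : ContDiffOn ℝ 2 Φ (HS d)
  int : ∀ x ∈ HS d, ∀ μ, SpecOK (d+1) lam Lam μ → Integrable (kint d s μ Φ x)
  null : ∀ x ∈ HS d, ∀ μ, SpecOK (d+1) lam Lam μ → ∫ y, kint d s μ Φ x y = 0

lemma kint_add (d : ℕ) (s : ℝ) (μ u v : EE d → ℝ) (x y : EE d) :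
    kint d s μ (fun z => u z + v z) x y = kint d s μ u x y + kint d s μ v x y := by
  unfold kint sd; ring

lemma kint_smul (d : ℕ) (s c : ℝ) (μ u : EE d → ℝ) (x y : EE d) :
    kint d s μ (fun z => c * u z) x y = c * kint d s μ u x y := by
  unfold kint sd; ring

lemma NullSol.add {d : ℕ} {s lam Lam : ℝ} {Φ Ψ : EE d → ℝ} (h1 : NullSol d s lam Lam Φ)
    (h2 : NullSol d s lam Lam Ψ) : NullSol d s lam Lam (fun z => Φ z + Ψ z) where
  c2 := h1.c2.add h2.c2
  int x hx μ hμ := by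
    have : kint d s μ (fun z => Φ z + Ψ z) x = fun y => kint d s μ Φ x y + kint d s μ Ψ x y := by
      ext y; exact kint_add ..
    rw [this]; exact (h1.int x hx μ hμ).add (h2.int x hx μ hμ)
  null x hx μ hμ := by
    simp only [kint_add]
    rw [integral_add (h1.int x hx μ hμ) (h2.int x hx μ hμ), h1.null x hx μ hμ, h2.null x hx μ hμ, add_zero]

lemma NullSol.smul {d : ℕ} {s lam Lam : ℝ} {Φ : EE d → ℝ} (c : ℝ) (h1 : NullSol d s lam Lam Φ) :
    NullSol d s lam Lam (fun z => c * Φ z) where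
  c2 := contDiffOn_const.mul h1.c2
  int x hx μ hμ := by
    have : kint d s μ (fun z => c * Φ z) x = fun y => c * kint d s μ Φ x y := by
      ext y; exact kint_smul ..
    rw [this]; exact (h1.int x hx μ hμ).const_mul c
  null x hx μ hμ := by
    simp only [kint_smul]
    rw [integral_const_mul, h1.null x hx μ hμ, mul_zero]

lemma NullSol.sub {d : ℕ} {s lam Lam : ℝ} {Φ Ψ : EE d → ℝ} (h1 : NullSol d s lam Lam Φ)
    (h2 : NullSol d s lam Lam Ψ) : NullSol d s lam Lam (fun z => Φ z - Ψ z) := by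
  have := h1.add (h2.smul (-1))
  convert this using 2; ring

lemma ray_null1 (d : ℕ) (s : ℝ) (μ : EE d → ℝ) (φ : ℝ → ℝ) (x : EE d)
    (h : ∫ y in Ioi (0:ℝ), (φ (x (Fin.last d) + y) + φ (x (Fin.last d) - y) - 2 * φ (x (Fin.last d))) * y ^ (-1-2*s) = 0) :
    ∫ y, kint d s μ (fun z => φ (z (Fin.last d))) x y = 0 := by
  apply polar0
  intro θ hθ
  set a := x (Fin.last d) with ha
  set c := θ (Fin.last d) with hc
  have e : ∀ r ∈ Ioi (0:ℝ), kint d s μ (fun z => φ (z (Fin.last d))) x (r • θ) * r ^ d =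
      (μ θ / 2) * ((φ (a + |c| * r) + φ (a - |c| * r) - 2 * φ a) * r ^ (-1-2*s)) := by
    intro r hr
    have hr : 0 < r := hr
    have e1 : ‖r • θ‖ = r := by rw [norm_smul, hθ, Real.norm_eq_abs, abs_of_pos hr, mul_one]
    have e2 : r⁻¹ • r • θ = θ := by rw [smul_smul, inv_mul_cancel₀ hr.ne', one_smul]
    have e3 : r ^ (-1-2*s) = r ^ d / r ^ (((d + 1 : ℕ) : ℝ) + 2 * s) := by
      rw [← Real.rpow_natCast, ← Real.rpow_sub hr]; congr 1; push_cast; ring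
    have e4 : φ (a + r * c) + φ (a - r * c) = φ (a + |c| * r) + φ (a - |c| * r) := by
      rcases abs_cases c with ⟨h, -⟩ | ⟨h, -⟩
      · rw [h, mul_comm]
      · rw [h, add_comm]; congr 2 <;> ring
    unfold kint sd
    rw [e1, e2, e3]
    simp only [PiLp.add_apply, PiLp.sub_apply, PiLp.smul_apply, smul_eq_mul, ← ha, ← hc, e4]
    ring
  rw [setIntegral_congr_fun measurableSet_Ioi e, integral_const_mul]
  by_cases hc0 : c = 0
  · simp [hc0, two_mul]
  · rw [ray_scale (fun y => φ (a + y) + φ (a - y) - 2 * φ a) _ h (abs_pos.2 hc0), mul_zero]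

lemma ray_null2 (d : ℕ) (s : ℝ) (μ : EE d → ℝ) (φ : ℝ → ℝ) (p : EE d) (a : ℝ)
    (h : ∫ y in Ioi (0:ℝ), (φ (a + y) - φ (a - y)) * y ^ (-(2*s)) = 0) :
    ∫ y : EE d, (⟪p, y⟫ / 2 * (φ (a + y (Fin.last d)) - φ (a - y (Fin.last d)))) * μ (‖y‖⁻¹ • y) /
      ‖y‖ ^ (((d + 1 : ℕ) : ℝ) + 2 * s) = 0 := by
  apply polar0
  intro θ hθ
  set c := θ (Fin.last d) with hc
  have e : ∀ r ∈ Ioi (0:ℝ), (⟪p, r • θ⟫ / 2 * (φ (a + (r • θ) (Fin.last d)) - φ (a - (r • θ) (Fin.last d)))) * μ (‖r • θ‖⁻¹ • r • θ) /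
      ‖r • θ‖ ^ (((d + 1 : ℕ) : ℝ) + 2 * s) * r ^ d =
      (μ θ * ⟪p, θ⟫ / 2 * SignType.sign c) * ((φ (a + |c| * r) - φ (a - |c| * r)) * r ^ (-(2*s))) := by
    intro r hr
    have hr : 0 < r := hr
    have e1 : ‖r • θ‖ = r := by rw [norm_smul, hθ, Real.norm_eq_abs, abs_of_pos hr, mul_one]
    have e2 : r⁻¹ • r • θ = θ := by rw [smul_smul, inv_mul_cancel₀ hr.ne', one_smul]
    have e3 : r ^ (-(2*s)) = r * r ^ d / r ^ (((d + 1 : ℕ) : ℝ) + 2 * s) := by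
      rw [← pow_succ', ← Real.rpow_natCast, ← Real.rpow_sub hr]; congr 1; push_cast; ring
    have e4 : φ (a + r * c) - φ (a - r * c) = SignType.sign c * (φ (a + |c| * r) - φ (a - |c| * r)) := by
      rcases lt_trichotomy c 0 with h | h | h
      · rw [abs_of_neg h, sign_neg h]; simp
        rw [mul_comm c r]; ring_nf
      · simp [h]
      · rw [abs_of_pos h, sign_pos h, mul_comm]; simp
    rw [e1, e2, e3, inner_smul_right]
    simp only [PiLp.smul_apply, smul_eq_mul, ← hc, e4]
    ring
  rw [setIntegral_congr_fun measurableSet_Ioi e, integral_const_mul]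
  by_cases hc0 : c = 0
  · simp [hc0]
  · rw [ray_scale (fun y => φ (a + y) - φ (a - y)) _ h (abs_pos.2 hc0), mul_zero]

lemma pp_le {s : ℝ} (hs0 : 0 < s) {d : ℕ} {t : ℝ} (ht : 0 ≤ t) (z : EE d) :
    pp s (z (Fin.last d) + t) ≤ (1+t) ^ s * (1 + ‖z‖) ^ (3*s/2) := by
  have h1 := le_abs_self (z (Fin.last d))
  have h2 := coord_le_norm z (Fin.last d)
  have h3 := norm_nonneg z
  unfold pp
  calc _ ≤ ((1+t) * (1 + ‖z‖)) ^ s := by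
        apply Real.rpow_le_rpow (le_max_right _ _) _ hs0.le
        apply max_le <;> nlinarith
    _ = (1+t) ^ s * (1+‖z‖) ^ s := Real.mul_rpow (by positivity) (by positivity)
    _ ≤ _ := by
        gcongr 2
        · linarith
        · linarith

lemma pp_c2 (d : ℕ) (s : ℝ) {t : ℝ} (ht : 0 ≤ t) :
    ContDiffOn ℝ 2 (fun z : EE d => pp s (z (Fin.last d) + t)) (HS d) := by
  have : ContDiffOn ℝ 2 (fun z : EE d => (z (Fin.last d) + t) ^ s) (HS d) := by
    intro x hx
    have hx : 0 < x (Fin.last d) := hx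
    apply ContDiffAt.contDiffWithinAt
    apply ContDiffAt.rpow_const_of_ne
    · fun_prop
    · positivity
  refine this.congr fun x hx => ?_
  have hx : 0 < x (Fin.last d) := hx
  exact pp_of_pos (by positivity)

section
variable {d : ℕ} {s lam Lam : ℝ}

lemma null_pp (hs0 : 0 < s) (hs1 : s < 1) (hlam : 0 < lam) (hlL : lam ≤ Lam) {t : ℝ} (ht : 0 ≤ t) :
    NullSol d s lam Lam (fun z => pp s (z (Fin.last d) + t)) where
  c2 := pp_c2 d s ht
  int x hx μ hμ := by
    obtain ⟨r, A, hr, hA, h⟩ := sd_of_contDiffAt ((pp_c2 d s ht).contDiffAt ((HS_open d).mem_nhds hx))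
    refine kint_integrable_growth hs0 hs1 hlam hlL hμ ?_ (K := (1+t) ^ s) ?_ hr hA h
    · have := (pp_cont hs0).measurable
      fun_prop
    · intro z; rw [abs_of_nonneg (pp_nonneg _ _)]; exact pp_le hs0 ht z
  null x hx μ hμ := by
    have hx : 0 < x (Fin.last d) := hx
    apply ray_null1 d s μ (fun r => pp s (r + t))
    have := oneD_F1 hs0 hs1 (a := x (Fin.last d) + t) (by positivity)
    refine Eq.trans ?_ this
    congr 1; ext y
    ring_nf

lemma null_w0 (hs0 : 0 < s) (hs1 : s < 1) (hlam : 0 < lam) (hlL : lam ≤ Lam) :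
    NullSol d s lam Lam (fun z => pp s (z (Fin.last d))) := by
  simpa using null_pp (d := d) hs0 hs1 hlam hlL (le_refl (0:ℝ))

lemma null_ft (hs0 : 0 < s) (hs1 : s < 1) (hlam : 0 < lam) (hlL : lam ≤ Lam) {t : ℝ} (ht : 0 ≤ t) :
    NullSol d s lam Lam (fun z => ft s t (z (Fin.last d))) :=
  (null_pp hs0 hs1 hlam hlL ht).sub (null_w0 hs0 hs1 hlam hlL)
end

lemma pp_mono {s : ℝ} (hs0 : 0 < s) : Monotone (pp s) := by
  intro a b hab
  exact Real.rpow_le_rpow (le_max_right _ _) (max_le_max_right 0 hab) hs0.le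

lemma ft_nonneg {s t : ℝ} (hs0 : 0 < s) (ht : 0 ≤ t) (z : ℝ) : 0 ≤ ft s t z :=
  sub_nonneg.2 (pp_mono hs0 (by linarith))

lemma pp_add_le {s : ℝ} (hs0 : 0 < s) (hs1 : s < 1) (z : ℝ) {t : ℝ} (ht : 0 ≤ t) : pp s (z + t) ≤ pp s z + t ^ s := by
  unfold pp
  calc _ ≤ (max z 0 + t) ^ s := by
        apply Real.rpow_le_rpow (le_max_right _ _) _ hs0.le
        apply max_le
        · linarith [le_max_left z 0]
        · linarith [le_max_right z 0]
    _ ≤ _ := Real.rpow_add_le_add_rpow (le_max_right _ _) ht hs0.le hs1.le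

lemma ft_le {s t : ℝ} (hs0 : 0 < s) (hs1 : s < 1) (ht : 0 ≤ t) (z : ℝ) : ft s t z ≤ t ^ s := by
  have := pp_add_le hs0 hs1 z ht
  unfold ft; linarith

lemma ft_le2 {s t : ℝ} (hs0 : 0 < s) (hs1 : s < 1) (ht : 0 ≤ t) {z : ℝ} (hz : 0 < z) :
    ft s t z ≤ s * (t * z ^ (s-1)) := by
  unfold ft
  rw [pp_of_pos hz, pp_of_pos (by linarith)]
  have h0 : 0 ≤ t / z := by positivity
  have h1 : (1 + t / z) ^ s ≤ 1 + s * (t / z) :=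
    rpow_one_add_le_one_add_mul_self (by linarith) hs0.le hs1.le
  have h2 : (z + t) ^ s = z ^ s * (1 + t / z) ^ s := by
    rw [← Real.mul_rpow hz.le (by positivity)]; congr 1; field_simp
  rw [h2, Real.rpow_sub_one hz.ne']
  have h3 : 0 < z ^ s := by positivity
  have : s * (t * (z ^ s / z)) = z ^ s * (s * (t / z)) := by ring
  rw [this]; nlinarith

lemma ft_zero {s t : ℝ} (hs0 : 0 < s) {z : ℝ} (ht : 0 ≤ t) (hz : z ≤ -t) : ft s t z = 0 := by
  unfold ft; rw [pp_of_nonpos hs0 (by linarith), pp_of_nonpos hs0 (by linarith), sub_zero]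

lemma ft_cont {s : ℝ} (hs0 : 0 < s) (t : ℝ) : Continuous (ft s t) := by
  have := pp_cont hs0
  unfold ft; fun_prop

lemma ft_far {s t : ℝ} (hs0 : 0 < s) (hs1 : s < 1) (ht : 0 ≤ t) {a : ℝ} (ha : 0 < a) (τ : ℝ) (hτ : τ ≠ 0) :
    ft s t (a + τ) ≤ (t ^ s * (2*a+2*t) ^ (1-s) + t) * |τ| ^ (s-1) := by
  have hp : 0 < |τ| := abs_pos.2 hτ
  have hq : 0 < |τ| ^ (s-1) := by positivity
  by_cases h1 : |τ| ≤ 2*a+2*t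
  · have : 1 ≤ (2*a+2*t) ^ (1-s) * |τ| ^ (s-1) := by
      have e : |τ| ^ (s-1) = (|τ| ^ (1-s))⁻¹ := by rw [← Real.rpow_neg hp.le]; congr 1; ring
      rw [e, ← div_eq_mul_inv, one_le_div (by positivity)]
      exact Real.rpow_le_rpow hp.le h1 (by linarith)
    have h2 := ft_le hs0 hs1 ht (a+τ)
    have h3 : 0 ≤ t ^ s := by positivity
    nlinarith
  · push Not at h1
    have hc : 0 ≤ t ^ s * (2*a+2*t) ^ (1-s) := by positivity
    rcases abs_cases τ with ⟨h, h'⟩ | ⟨h, h'⟩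
    · have h2 := ft_le2 hs0 hs1 ht (z := a + τ) (by linarith)
      have h3 : (a+τ) ^ (s-1) ≤ |τ| ^ (s-1) := by
        apply Real.rpow_le_rpow_of_nonpos hp <;> linarith
      have h4 : 0 ≤ (a+τ) ^ (s-1) := by apply Real.rpow_nonneg; linarith
      nlinarith [mul_nonneg ht h4, mul_le_mul_of_nonneg_left h3 ht, mul_nonneg hc hq.le]
    · rw [ft_zero hs0 ht (by linarith)]; positivity

section
variable {d : ℕ} {s lam Lam : ℝ}

lemma null_pft (hs0 : 0 < s) (hs1 : s < 1) (hlam : 0 < lam) (hlL : lam ≤ Lam) {t : ℝ} (ht : 0 < t) (p : EE d) :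
    NullSol d s lam Lam (fun z => ⟪p, z⟫ * ft s t (z (Fin.last d))) := by
  have hL : 0 < Lam := by linarith
  have hf := null_ft (d := d) hs0 hs1 hlam hlL ht.le
  have hc2 : ContDiffOn ℝ 2 (fun z : EE d => ⟪p, z⟫ * ft s t (z (Fin.last d))) (HS d) := by
    apply ContDiffOn.mul _ hf.c2
    exact (contDiff_const.inner ℝ contDiff_id).contDiffOn
  have hm : Measurable (fun z : EE d => ⟪p, z⟫ * ft s t (z (Fin.last d))) := by
    have := (ft_cont hs0 t).measurable
    fun_prop
  have hsd : ∀ x y : EE d, sd (fun z : EE d => ⟪p, z⟫ * ft s t (z (Fin.last d))) x y =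
      ⟪p, x⟫ * sd (fun z : EE d => ft s t (z (Fin.last d))) x y +
      ⟪p, y⟫ / 2 * (ft s t (x (Fin.last d) + y (Fin.last d)) - ft s t (x (Fin.last d) - y (Fin.last d))) := by
    intro x y; unfold sd; simp only [inner_add_right, inner_sub_right, PiLp.add_apply, PiLp.sub_apply]; ring
  have hinteg : ∀ x ∈ HS d, ∀ μ, SpecOK (d+1) lam Lam μ →
      Integrable (kint d s μ (fun z : EE d => ⟪p, z⟫ * ft s t (z (Fin.last d))) x) := by
    intro x hx μ hμ
    have hx : 0 < x (Fin.last d) := hx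
    obtain ⟨r, A, hr, hA, h⟩ := sd_of_contDiffAt (hc2.contDiffAt ((HS_open d).mem_nhds hx))
    set B : ℝ := |⟪p, x⟫| * (2 * t ^ s) + ‖p‖ * t ^ s with hB
    set C : ℝ := ‖p‖ * (t ^ s * (2*(x (Fin.last d))+2*t) ^ (1-s) + t) with hC
    have hC0 : 0 ≤ C := by positivity
    have hT : 0 ≤ t ^ s := by positivity
    refine (((dom_int d (s := s) A B (q := 0) (p := 2) (by linarith) (by linarith) hr).add
      ((J_int hs0 d).const_mul C)).const_mul Lam).mono' (kint_meas hμ.1 hm x).aestronglyMeasurable ?_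
    filter_upwards [compl_mem_ae_iff.2 (measure_singleton (0 : EE d))] with y hyn
    have hY : 0 < ‖y‖ := norm_pos_iff.2 hyn
    refine (kint_le hs0 hlam hμ _ x y).trans ?_
    gcongr
    have hJ : 0 ≤ C * (if ‖y‖ < 1 then 0 else |y (Fin.last d)| ^ (s-1) * ‖y‖ ^ (-(d + 2*s))) := by
      split_ifs <;> positivity
    have hb : ∀ z, |ft s t z| ≤ t ^ s := fun z => by
      rw [abs_of_nonneg (ft_nonneg hs0 ht.le _)]; exact ft_le hs0 hs1 ht.le z
    simp only [Pi.add_apply]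
    by_cases hyr : ‖y‖ < r
    · refine le_add_of_le_of_nonneg ?_ hJ
      simp only [dom, hyr, if_true, mul_zero, add_zero]
      calc _ ≤ (A * ‖y‖ ^ (2:ℝ)) * ‖y‖ ^ (-((d:ℝ)+1+2*s)) := by gcongr; exact h y hyr
        _ = _ := by rw [mul_assoc, ← Real.rpow_add hY]; simp [sub_eq_add_neg]
    · have h1 : |sd (fun z : EE d => ft s t (z (Fin.last d))) x y| ≤ 2 * t ^ s := by
        unfold sd
        have a1 := abs_le.1 (hb ((x+y) (Fin.last d)))
        have a2 := abs_le.1 (hb ((x-y) (Fin.last d)))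
        have a3 := abs_le.1 (hb (x (Fin.last d)))
        rw [abs_le]; constructor <;> linarith
      have h2 : |⟪p, y⟫ / 2 * (ft s t (x (Fin.last d) + y (Fin.last d)) - ft s t (x (Fin.last d) - y (Fin.last d)))|
          ≤ ‖p‖ * t ^ s + (if ‖y‖ < 1 then 0 else C * (|y (Fin.last d)| ^ (s-1) * ‖y‖)) := by
        by_cases hyn : y (Fin.last d) = 0
        · rw [hyn]; simp
          split_ifs <;> positivity
        rw [abs_mul, abs_div, abs_two]
        have c1 := abs_real_inner_le_norm p y
        have c2 := hb (x (Fin.last d) + y (Fin.last d))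
        have c3 := hb (x (Fin.last d) - y (Fin.last d))
        have c4 := abs_sub (ft s t (x (Fin.last d) + y (Fin.last d))) (ft s t (x (Fin.last d) - y (Fin.last d)))
        split_ifs with hy1
        · rw [add_zero]
          calc _ ≤ (‖p‖ * 1) / 2 * (2 * t ^ s) := by
                gcongr
                · refine c1.trans ?_; gcongr
                · linarith
            _ = _ := by ring
        · have c5 := ft_far hs0 hs1 ht.le hx (y (Fin.last d)) hyn
          have c6 := ft_far hs0 hs1 ht.le hx (-y (Fin.last d)) (neg_ne_zero.2 hyn)
          rw [← sub_eq_add_neg, abs_neg] at c6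
          rw [abs_of_nonneg (ft_nonneg hs0 ht.le _), abs_of_nonneg (ft_nonneg hs0 ht.le _)] at c4
          refine le_add_of_nonneg_of_le (by positivity) ?_
          calc _ ≤ (‖p‖ * ‖y‖) / 2 * (2 * ((t ^ s * (2*(x (Fin.last d))+2*t) ^ (1-s) + t) * |y (Fin.last d)| ^ (s-1))) := by
                gcongr; linarith
            _ = _ := by rw [hC]; ring
      have h3 : |sd (fun z : EE d => ⟪p, z⟫ * ft s t (z (Fin.last d))) x y| ≤ B +
          (if ‖y‖ < 1 then 0 else C * (|y (Fin.last d)| ^ (s-1) * ‖y‖)) := by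
        rw [hsd]
        refine (abs_add_le _ _).trans ?_
        rw [abs_mul ⟪p, x⟫, hB]
        have : |⟪p, x⟫| * |sd (fun z : EE d => ft s t (z (Fin.last d))) x y| ≤ |⟪p, x⟫| * (2 * t ^ s) := by gcongr
        linarith
      calc _ ≤ (B + (if ‖y‖ < 1 then 0 else C * (|y (Fin.last d)| ^ (s-1) * ‖y‖))) * ‖y‖ ^ (-((d:ℝ)+1+2*s)) := by gcongr
        _ = _ := by
          have e : ‖y‖ ^ (-((d:ℝ) + 2*s)) = ‖y‖ * ‖y‖ ^ (-((d:ℝ)+1+2*s)) := by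
            nth_rw 2 [← Real.rpow_one ‖y‖]
            rw [← Real.rpow_add hY]; congr 1; ring
          simp only [dom, hyr, if_false, e]
          split_ifs
          · simp
          · simp; ring
  refine ⟨hc2, hinteg, ?_⟩
  intro x hx μ hμ
  have hxp : 0 < x (Fin.last d) := hx
  have e : ∀ y, (⟪p, y⟫ / 2 * (ft s t (x (Fin.last d) + y (Fin.last d)) - ft s t (x (Fin.last d) - y (Fin.last d)))) * μ (‖y‖⁻¹ • y) /
      ‖y‖ ^ (((d + 1 : ℕ) : ℝ) + 2 * s) = kint d s μ (fun z : EE d => ⟪p, z⟫ * ft s t (z (Fin.last d))) x y -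
        ⟪p, x⟫ * kint d s μ (fun z : EE d => ft s t (z (Fin.last d))) x y := by
    intro y; unfold kint; rw [hsd]; ring
  have h0 := ray_null2 d s μ (ft s t) p (x (Fin.last d)) (oneD_F2 hs0 hs1 hxp ht)
  simp only [e] at h0
  rw [integral_sub (hinteg x hx μ hμ) ((hf.int x hx μ hμ).const_mul _), integral_const_mul, hf.null x hx μ hμ] at h0
  linarith
end

lemma integral_add_null {α : Type*} [MeasurableSpace α] {ν : Measure α} {f g : α → ℝ} (hg : Integrable g ν)
    (h0 : ∫ x, g x ∂ν = 0) : ∫ x, (f x + g x) ∂ν = ∫ x, f x ∂ν := by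
  by_cases hf : Integrable f ν
  · rw [integral_add hf hg, h0, add_zero]
  · rw [integral_undef hf, integral_undef]
    intro h
    apply hf
    have := h.sub hg
    refine this.congr (Filter.Eventually.of_forall fun x => ?_)
    simp

lemma NullSol.kerOp_add {d : ℕ} {s lam Lam : ℝ} {Φ : EE d → ℝ} (h : NullSol d s lam Lam Φ) (F : EE d → ℝ)
    {x : EE d} (hx : x ∈ HS d) {μ : EE d → ℝ} (hμ : SpecOK (d+1) lam Lam μ) :
    kerOp (d+1) s μ (fun z => F z + Φ z) x = kerOp (d+1) s μ F x := by
  rw [kerOp_eq, kerOp_eq]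
  simp only [kint_add]
  rw [integral_add_null (h.int x hx μ hμ) (h.null x hx μ hμ)]

lemma NullSol.Mminus_add {d : ℕ} {s lam Lam : ℝ} {Φ : EE d → ℝ} (h : NullSol d s lam Lam Φ) (F : EE d → ℝ)
    {x : EE d} (hx : x ∈ HS d) :
    Mminus (d+1) s lam Lam (fun z => F z + Φ z) x = Mminus (d+1) s lam Lam F x := by
  unfold Mminus
  congr 1; ext z
  constructor
  · rintro ⟨μ, hμ, rfl⟩; exact ⟨μ, hμ, h.kerOp_add F hx hμ⟩
  · rintro ⟨μ, hμ, rfl⟩; exact ⟨μ, hμ, (h.kerOp_add F hx hμ).symm⟩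

lemma ViscSuper.add_null {d : ℕ} {s lam Lam : ℝ} {G Φ : EE d → ℝ} (hG : ViscSuper (d+1) s lam Lam G (HS d))
    (h : NullSol d s lam Lam Φ) : ViscSuper (d+1) s lam Lam (fun z => G z + Φ z) (HS d) := by
  intro x hx r hr hb φ hφ he hle
  have := hG x hx r hr hb (fun z => φ z - Φ z) (hφ.sub (h.c2.mono hb)) (by simp [he])
    (fun y hy => by have := hle y hy; simp only at this ⊢; linarith)
  rw [← h.Mminus_add _ hx] at this
  convert this using 2
  ext z; split_ifs <;> ring

lemma ViscSub.neg {d : ℕ} {s lam Lam : ℝ} {G : EE d → ℝ} (hG : ViscSub (d+1) s lam Lam G (HS d)) :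
    ViscSuper (d+1) s lam Lam (fun z => - G z) (HS d) := by
  intro x hx r hr hb φ hφ he hle
  have := hG x hx r hr hb (fun z => - φ z) hφ.neg (by simp [he])
    (fun y hy => by have := hle y hy; simp only at this ⊢; linarith)
  have e : Mminus (d+1) s lam Lam (fun y => if ‖y - x‖ < r then φ y else - G y) x =
      - Mplus (d+1) s lam Lam (fun y => if ‖y - x‖ < r then - φ y else G y) x := by
    unfold Mminus Mplus
    rw [Real.sInf_def]
    congr 2; ext z
    have hk : ∀ μ, kerOp (d+1) s μ (fun y => if ‖y - x‖ < r then φ y else - G y) x =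
        - kerOp (d+1) s μ (fun y => if ‖y - x‖ < r then - φ y else G y) x := by
      intro μ
      rw [kerOp_eq, kerOp_eq, ← mul_neg, ← integral_neg]
      congr 2; ext y
      have : (fun y => if ‖y - x‖ < r then φ y else - G y) = fun y => (-1) * (if ‖y - x‖ < r then - φ y else G y) := by
        ext y; split_ifs <;> ring
      rw [this, kint_smul]; ring
    constructor
    · rintro ⟨μ, hμ, h⟩; exact ⟨μ, hμ, by rw [hk] at h; linarith⟩
    · rintro ⟨μ, hμ, h⟩; exact ⟨μ, hμ, by rw [hk]; linarith⟩
  rw [e]; linarith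

lemma kint_scale {d : ℕ} (s : ℝ) (μ F : EE d → ℝ) {R : ℝ} (hR : 0 < R) (x y : EE d) :
    kint d s μ (fun z => F (R • z)) x y = R ^ (((d + 1 : ℕ) : ℝ) + 2 * s) * kint d s μ F (R • x) (R • y) := by
  unfold kint sd
  have e1 : ‖R • y‖ = R * ‖y‖ := by rw [norm_smul, Real.norm_eq_abs, abs_of_pos hR]
  have e2 : (R * ‖y‖)⁻¹ • R • y = ‖y‖⁻¹ • y := by
    rw [smul_smul]; congr 1; field_simp
  rw [e1, e2, Real.mul_rpow hR.le (norm_nonneg _)]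
  simp only [smul_add, smul_sub]
  have : R ^ (((d + 1 : ℕ) : ℝ) + 2 * s) ≠ 0 := by positivity
  rw [← mul_div_assoc, mul_div_mul_left _ _ this]

/-- scaling constant -/
noncomputable def scst (d : ℕ) (s R : ℝ) : ℝ :=
  R ^ (((d + 1 : ℕ) : ℝ) + 2 * s) * |(R ^ (Module.finrank ℝ (EE d)))⁻¹|

lemma scst_pos (d : ℕ) (s : ℝ) {R : ℝ} (hR : 0 < R) : 0 < scst d s R := by
  unfold scst; positivity

lemma kint_integral_scale {d : ℕ} (s : ℝ) (μ F : EE d → ℝ) {R : ℝ} (hR : 0 < R) (x : EE d) :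
    ∫ y, kint d s μ (fun z => F (R • z)) x y = scst d s R * ∫ y, kint d s μ F (R • x) y := by
  simp only [kint_scale s μ F hR]
  rw [integral_const_mul, Measure.integral_comp_smul volume (kint d s μ F (R • x)) R, scst, smul_eq_mul, mul_assoc]

lemma HS_smul {d : ℕ} {R : ℝ} (hR : 0 < R) {x : EE d} (hx : x ∈ HS d) : R • x ∈ HS d := by
  have hx : 0 < x (Fin.last d) := hx
  change 0 < R * x (Fin.last d)
  positivity

lemma NullSol.scale {d : ℕ} {s lam Lam : ℝ} {Φ : EE d → ℝ} (h : NullSol d s lam Lam Φ) {R : ℝ} (hR : 0 < R) :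
    NullSol d s lam Lam (fun z => Φ (R • z)) where
  c2 := h.c2.comp (contDiff_const_smul R).contDiffOn fun x hx => HS_smul hR hx
  int x hx μ hμ := by
    have e : kint d s μ (fun z => Φ (R • z)) x = fun y => R ^ (((d + 1 : ℕ) : ℝ) + 2 * s) * kint d s μ Φ (R • x) (R • y) := by
      ext y; exact kint_scale s μ Φ hR x y
    rw [e]
    exact ((h.int _ (HS_smul hR hx) μ hμ).comp_smul hR.ne').const_mul _
  null x hx μ hμ := by
    rw [kint_integral_scale s μ Φ hR, h.null _ (HS_smul hR hx) μ hμ, mul_zero]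

lemma Mminus_scale {d : ℕ} (s lam Lam : ℝ) (F : EE d → ℝ) {R : ℝ} (hR : 0 < R) (x : EE d) :
    Mminus (d+1) s lam Lam (fun z => F (R • z)) x = scst d s R * Mminus (d+1) s lam Lam F (R • x) := by
  unfold Mminus
  rw [← smul_eq_mul, ← Real.sInf_smul_of_nonneg (scst_pos d s hR).le]
  have hk : ∀ μ, kerOp (d+1) s μ (fun z => F (R • z)) x = scst d s R * kerOp (d+1) s μ F (R • x) := by
    intro μ; rw [kerOp_eq, kerOp_eq, kint_integral_scale s μ F hR]; ring
  congr 1; ext z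
  rw [Set.mem_smul_set]
  constructor
  · rintro ⟨μ, hμ, rfl⟩
    exact ⟨_, ⟨μ, hμ, rfl⟩, (hk μ).symm⟩
  · rintro ⟨_, ⟨μ, hμ, rfl⟩, rfl⟩
    exact ⟨μ, hμ, (hk μ).symm⟩

lemma ViscSuper.scale {d : ℕ} {s lam Lam : ℝ} {G : EE d → ℝ} (hG : ViscSuper (d+1) s lam Lam G (HS d))
    {R : ℝ} (hR : 0 < R) : ViscSuper (d+1) s lam Lam (fun z => G (R • z)) (HS d) := by
  intro x hx r hr hb φ hφ he hle
  have hmap : ∀ z ∈ ball (R • x) (R * r), R⁻¹ • z ∈ ball x r := by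
    intro z hz
    rw [mem_ball, dist_eq_norm] at hz ⊢
    have : R⁻¹ • z - x = R⁻¹ • (z - R • x) := by rw [smul_sub, smul_smul, inv_mul_cancel₀ hR.ne', one_smul]
    rw [this, norm_smul, Real.norm_eq_abs, abs_of_pos (by positivity), inv_mul_lt_iff₀ hR]; exact hz
  have hinv : ∀ z : EE d, R • R⁻¹ • z = z := fun z => by rw [smul_smul, mul_inv_cancel₀ hR.ne', one_smul]
  have hinv' : ∀ z : EE d, R⁻¹ • R • z = z := fun z => by rw [smul_smul, inv_mul_cancel₀ hR.ne', one_smul]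
  have := hG (R • x) (HS_smul hR hx) (R * r) (by positivity)
    (fun z hz => by
      have := HS_smul hR (hb (hmap z hz))
      rwa [hinv] at this)
    (fun z => φ (R⁻¹ • z)) (hφ.comp (contDiff_const_smul R⁻¹).contDiffOn hmap) (by
      simp only [hinv', he])
    (fun z hz => by
      have := hle _ (hmap z hz)
      simpa only [hinv] using this)
  have e : (fun y => if ‖y - x‖ < r then φ y else G (R • y)) =
      fun y => (fun z => if ‖z - R • x‖ < R * r then φ (R⁻¹ • z) else G z) (R • y) := by
    ext y
    simp only [hinv', ← smul_sub, norm_smul, Real.norm_eq_abs, abs_of_pos hR, mul_lt_mul_iff_right₀ hR]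
  rw [e, Mminus_scale s lam Lam (fun z => if ‖z - R • x‖ < R * r then φ (R⁻¹ • z) else G z) hR]
  exact mul_nonpos_of_nonneg_of_nonpos (scst_pos d s hR).le this

/-- The cutoff. -/
noncomputable def bmp (d : ℕ) : ContDiffBump (0 : EE d) := ⟨1, 2, one_pos, one_lt_two⟩

/-- The barrier. -/
noncomputable def psi (d : ℕ) (s : ℝ) (x : EE d) : ℝ := bmp d x * pp s (x (Fin.last d))

lemma pp_holder {s : ℝ} (hs0 : 0 < s) (hs1 : s < 1) (a b : ℝ) : |pp s a - pp s b| ≤ |a - b| ^ s := by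
  wlog h : b ≤ a generalizing a b
  · rw [abs_sub_comm, abs_sub_comm a b]; exact this b a (le_of_not_ge h)
  rw [abs_of_nonneg (sub_nonneg.2 (pp_mono hs0 h)), abs_of_nonneg (sub_nonneg.2 h)]
  have := pp_add_le hs0 hs1 b (sub_nonneg.2 h)
  rw [add_sub_cancel] at this; linarith

lemma w0_holder {s : ℝ} (hs0 : 0 < s) (hs1 : s < 1) {d : ℕ} (x y : EE d) :
    |pp s (x (Fin.last d)) - pp s (y (Fin.last d))| ≤ ‖x - y‖ ^ s := by
  refine (pp_holder hs0 hs1 _ _).trans ?_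
  apply Real.rpow_le_rpow (abs_nonneg _) _ hs0.le
  exact coord_le_norm (x - y) (Fin.last d)

lemma w0_le {s : ℝ} (hs0 : 0 < s) {d : ℕ} (x : EE d) : pp s (x (Fin.last d)) ≤ ‖x‖ ^ s := by
  apply Real.rpow_le_rpow (le_max_right _ _) _ hs0.le
  exact max_le ((le_abs_self _).trans (coord_le_norm x _)) (norm_nonneg _)

section
variable {d : ℕ} {s lam Lam : ℝ}

lemma psi_cont (hs0 : 0 < s) : Continuous (psi d s) := by
  have := pp_cont hs0
  have h2 := (bmp d).continuous
  unfold psi; fun_prop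

lemma psi_c2 : ContDiffOn ℝ 2 (psi d s) (HS d) := by
  have := pp_c2 d s (le_refl (0:ℝ))
  simp only [add_zero] at this
  exact ((bmp d).contDiff.contDiffOn).mul this

lemma barrier (hs0 : 0 < s) (hs1 : s < 1) (hlam : 0 < lam) (hlL : lam ≤ Lam) :
    ∃ C : ℝ, 0 ≤ C ∧ ∀ x ∈ HS d, ‖x‖ < 2 → ∀ μ, SpecOK (d+1) lam Lam μ →
      Integrable (kint d s μ (psi d s) x) ∧ -C ≤ ∫ y, kint d s μ (psi d s) x y := by
  have hcd : ContDiff ℝ 2 (bmp d) := (bmp d).contDiff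
  obtain ⟨L1, hL1⟩ := hcd.lipschitzWith_of_hasCompactSupport (bmp d).hasCompactSupport (by norm_num)
  have hcd' : ContDiff ℝ 1 (fderiv ℝ (bmp d)) := hcd.fderiv_right (by norm_num)
  obtain ⟨K, hK⟩ := hcd'.lipschitzWith_of_hasCompactSupport ((bmp d).hasCompactSupport.fderiv (𝕜 := ℝ)) (by norm_num)
  have hsη : ∀ x y : EE d, |sd (bmp d) x y| ≤ K * ‖y‖ ^ (2:ℝ) := by
    intro x y
    refine sd_le_of_fderiv (fun z _ => hcd.differentiable (by norm_num) z) (fun z _ => ?_) K.2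
    simpa [dist_eq_norm] using hK.dist_le_mul z x
  have hη1 : ∀ x, 0 ≤ bmp d x ∧ bmp d x ≤ 1 := fun x => ⟨(bmp d).nonneg, (bmp d).le_one⟩
  have hL : 0 < Lam := by linarith
  have hw0 := null_w0 (d := d) hs0 hs1 hlam hlL
  set A : ℝ := 2 * K + L1
  have hA : 0 ≤ A := by have := K.2; have := L1.2; positivity
  have hdi := dom_int d (s := s) A 5 (p := 1+s) (q := s) (r := 1) (by linarith) (by linarith) one_pos
  have hdom0 : ∀ y, 0 ≤ dom d s A (1+s) 5 s 1 y := by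
    intro y; unfold dom; split_ifs <;> positivity
  refine ⟨Lam * ∫ y, dom d s A (1+s) 5 s 1 y, ?_, ?_⟩
  · have : 0 ≤ ∫ y, dom d s A (1+s) 5 s 1 y := integral_nonneg hdom0
    positivity
  intro x hx hx2 μ hμ
  set v : EE d → ℝ := fun z => psi d s z + (-bmp d x) * pp s (z (Fin.last d)) with hv
  have hvm : Measurable v := by
    have h1 := (psi_cont (d := d) hs0).measurable
    have h2 := (pp_cont hs0).measurable
    fun_prop
  have hW : pp s (x (Fin.last d)) ≤ 2 := by
    refine (w0_le hs0 x).trans ?_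
    calc ‖x‖ ^ s ≤ 2 ^ s := Real.rpow_le_rpow (norm_nonneg _) hx2.le hs0.le
      _ ≤ 2 ^ (1:ℝ) := Real.rpow_le_rpow_of_exponent_le (by norm_num) hs1.le
      _ = 2 := by norm_num
  have hW0 := pp_nonneg s (x (Fin.last d))
  have hsv : ∀ y, sd v x y = pp s (x (Fin.last d)) * sd (bmp d) x y +
      ((bmp d (x+y) - bmp d x) * (pp s ((x+y) (Fin.last d)) - pp s (x (Fin.last d))) +
       (bmp d (x-y) - bmp d x) * (pp s ((x-y) (Fin.last d)) - pp s (x (Fin.last d))))/2 := by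
    intro y; simp only [hv, sd, psi]; ring
  have hwd : ∀ y : EE d, |pp s ((x+y) (Fin.last d)) - pp s (x (Fin.last d))| ≤ ‖y‖ ^ s := fun y => by
    simpa using w0_holder hs0 hs1 (x+y) x
  have hwd' : ∀ y : EE d, |pp s ((x-y) (Fin.last d)) - pp s (x (Fin.last d))| ≤ ‖y‖ ^ s := fun y => by
    simpa using w0_holder hs0 hs1 (x-y) x
  have hmain : ∀ y : EE d, ∀ D : ℝ, 0 ≤ D → |bmp d (x+y) - bmp d x| ≤ D → |bmp d (x-y) - bmp d x| ≤ D →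
      |sd v x y| ≤ 2 * |sd (bmp d) x y| + D * ‖y‖ ^ s := by
    intro y D hD h1 h2
    rw [hsv]
    refine (abs_add_le _ _).trans ?_
    rw [abs_mul, abs_of_nonneg hW0, abs_div, abs_two]
    have e1 := abs_add_le ((bmp d (x+y) - bmp d x) * (pp s ((x+y) (Fin.last d)) - pp s (x (Fin.last d))))
       ((bmp d (x-y) - bmp d x) * (pp s ((x-y) (Fin.last d)) - pp s (x (Fin.last d))))
    rw [abs_mul, abs_mul] at e1
    have e2 := mul_le_mul h1 (hwd y) (abs_nonneg _) hD
    have e3 := mul_le_mul h2 (hwd' y) (abs_nonneg _) hD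
    have e4 := mul_le_mul_of_nonneg_right hW (abs_nonneg (sd (bmp d) x y))
    linarith
  have h1 : ∀ y, ‖y‖ < 1 → |sd v x y| ≤ A * ‖y‖ ^ (1+s) := by
    intro y hy
    by_cases hy0 : y = 0
    · subst hy0
      have : sd v x 0 = 0 := by unfold sd; simp
      rw [this]; simp; positivity
    have hY : 0 < ‖y‖ := norm_pos_iff.2 hy0
    have a1 := hL1.dist_le_mul (x+y) x
    have a2 := hL1.dist_le_mul (x-y) x
    simp only [dist_eq_norm, Real.norm_eq_abs, add_sub_cancel_left, sub_sub_cancel_left, norm_neg] at a1 a2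
    have := hmain y (L1 * ‖y‖) (by positivity) a1 a2
    have e5 : ‖y‖ ^ (2:ℝ) ≤ ‖y‖ ^ (1+s) := Real.rpow_le_rpow_of_exponent_ge hY hy.le (by linarith)
    have e6 : ‖y‖ ^ (1+s) = ‖y‖ * ‖y‖ ^ s := by rw [Real.rpow_add hY, Real.rpow_one]
    have e7 := hsη x y
    have e8 := mul_le_mul_of_nonneg_left e5 K.2
    simp only [NNReal.val_eq_coe] at e8
    calc _ ≤ _ := this
      _ ≤ 2 * (K * ‖y‖ ^ (1+s)) + L1 * ‖y‖ ^ (1+s) := by rw [e6] at *; linarith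
      _ = _ := by simp only [A]; ring
  have h2 : ∀ y, 1 ≤ ‖y‖ → |sd v x y| ≤ 5 * ‖y‖ ^ s := by
    intro y hy
    have b1 := hη1 (x+y)
    have b2 := hη1 (x-y)
    have b3 := hη1 x
    have := hmain y 1 (by norm_num) (by rw [abs_le]; constructor <;> linarith) (by rw [abs_le]; constructor <;> linarith)
    have b4 : |sd (bmp d) x y| ≤ 1 := by unfold sd; rw [abs_le]; constructor <;> linarith
    have b5 : 1 ≤ ‖y‖ ^ s := Real.one_le_rpow hy hs0.le
    linarith
  have hvi : Integrable (kint d s μ v x) :=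
    kint_integrable hs0 hlam hlL hμ hvm one_pos hA (by linarith) (by linarith) h1 h2
  have hb := fun y => kint_dom hs0 hlam hlL hμ one_pos hA h1 h2 y
  have e : kint d s μ (psi d s) x = fun y => kint d s μ v x y + bmp d x * kint d s μ (fun z => pp s (z (Fin.last d))) x y := by
    ext y; unfold kint sd; simp only [hv]; ring
  have hwi := (hw0.int x hx μ hμ).const_mul (bmp d x)
  rw [e]
  refine ⟨hvi.add hwi, ?_⟩
  rw [integral_add hvi hwi, integral_const_mul, hw0.null x hx μ hμ, mul_zero, add_zero]
  have : |∫ y, kint d s μ v x y| ≤ ∫ y, Lam * dom d s A (1+s) 5 s 1 y := by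
    refine (abs_integral_le_integral_abs).trans ?_
    exact integral_mono hvi.abs (hdi.const_mul Lam) hb
  rw [integral_const_mul] at this
  exact (abs_le.1 this).1
end

/-- The reference ball where mass is measured. -/
noncomputable def AA (d : ℕ) : Set (EE d) := closedBall (EuclideanSpace.single (Fin.last d) (4:ℝ)) 1

lemma AA_norm {d : ℕ} {z : EE d} (hz : z ∈ AA d) : 3 ≤ ‖z‖ ∧ ‖z‖ ≤ 5 := by
  have h : ‖z - EuclideanSpace.single (Fin.last d) (4:ℝ)‖ ≤ 1 := by simpa [AA, dist_eq_norm] using hz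
  have h4 : ‖(EuclideanSpace.single (Fin.last d) (4:ℝ) : EE d)‖ = 4 := by simp
  have h1 := norm_sub_norm_le z (EuclideanSpace.single (Fin.last d) (4:ℝ))
  have h2 := norm_sub_norm_le (EuclideanSpace.single (Fin.last d) (4:ℝ)) z
  rw [norm_sub_rev] at h2
  constructor <;> linarith

section
variable {d : ℕ} {s lam Lam : ℝ}

lemma growth_lemma (hs0 : 0 < s) (hs1 : s < 1) (hlam : 0 < lam) (hlL : lam ≤ Lam) :
    ∃ C1 C2 : ℝ, 0 < C1 ∧ 0 < C2 ∧ ∀ (V : EE d → ℝ) (K τ ε : ℝ), Continuous V →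
      (∀ z, |V z| ≤ K * (1 + ‖z‖) ^ (3*s/2)) → ViscSuper (d+1) s lam Lam V (HS d) →
      (∀ z, z (Fin.last d) ≤ 0 → 0 ≤ V z) → (∀ z, ‖z‖ ≤ 8 → 0 ≤ V z) → 0 ≤ τ →
      (∀ z, 8 ≤ ‖z‖ → -(τ * ‖z‖ ^ (3*s/2)) ≤ V z) → 0 < ε → ε * C1 + τ * C2 < ∫ z in AA d, V z →
      ∀ x ∈ HS d, ‖x‖ ≤ 1 → ε * pp s (x (Fin.last d)) ≤ V x := by
  obtain ⟨C, hC0, hC⟩ := barrier (d := d) hs0 hs1 hlam hlL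
  have hL : 0 < Lam := by linarith
  set N : ℝ := ((d + 1 : ℕ) : ℝ) + 2 * s with hN
  have hN0 : 0 < N := by positivity
  set c : ℝ := lam * (7 ^ N)⁻¹ with hc
  have hc0 : 0 < c := by positivity
  have hdi := dom_int d (s := s) 0 4 (p := 2) (q := 3*s/2) (r := 1) (by linarith) (by linarith) one_pos
  have hdom0 : ∀ y, 0 ≤ dom d s 0 2 4 (3*s/2) 1 y := by
    intro y; unfold dom; split_ifs <;> positivity
  set D : ℝ := ∫ y, dom d s 0 2 4 (3*s/2) 1 y with hD
  have hD0 : 0 ≤ D := integral_nonneg hdom0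
  refine ⟨(C + 1) / c, (Lam * D + 1) / c, by positivity, by positivity, ?_⟩
  intro V K τ ε hVc hVK hVs hVn hV8 hτ hVτ hε hI x1 hx1 hx1n
  by_contra hlt
  push Not at hlt
  have hψc := psi_cont (d := d) hs0
  -- minimum point
  obtain ⟨x0, hx0, hmin⟩ := (isCompact_closedBall (0 : EE d) 2).exists_isMinOn ⟨0, by simp⟩
    ((hVc.sub (hψc.const_smul ε)).continuousOn)
  simp only [isMinOn_iff, Pi.sub_apply, Pi.smul_apply, smul_eq_mul] at hmin
  set m : ℝ := V x0 - ε * psi d s x0 with hm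
  have hψ1 : psi d s x1 = pp s (x1 (Fin.last d)) := by
    unfold psi
    rw [(bmp d).one_of_mem_closedBall (by simpa [bmp] using hx1n), one_mul]
  have hψ2 : ∀ z : EE d, 2 ≤ ‖z‖ → psi d s z = 0 := by
    intro z hz
    unfold psi
    rw [(bmp d).zero_of_le_dist (by simpa [bmp] using hz), zero_mul]
  have hm0 : m < 0 := by
    have := hmin x1 (by simp; linarith)
    rw [hψ1] at this; linarith
  have hx02 : ‖x0‖ < 2 := by
    have h2 : ‖x0‖ ≤ 2 := by simpa using hx0
    by_contra h
    push Not at h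
    have := hV8 x0 (by linarith)
    rw [hm, hψ2 x0 h] at hm0; linarith
  have hx0H : x0 ∈ HS d := by
    by_contra h
    have h : x0 (Fin.last d) ≤ 0 := not_lt.1 h
    have := hVn x0 h
    have e : psi d s x0 = 0 := by unfold psi; rw [pp_of_nonpos hs0 h, mul_zero]
    rw [hm, e] at hm0; linarith
  obtain ⟨r, hr, hrb⟩ := Metric.isOpen_iff.1 ((HS_open d).inter (isOpen_ball (x := (0 : EE d)) (ε := 2))) x0
    ⟨hx0H, by simpa using hx02⟩
  set φ : EE d → ℝ := fun z => ε * psi d s z + m with hφ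
  have hφ2 : ContDiffOn ℝ 2 φ (HS d) := (contDiffOn_const.mul psi_c2).add contDiffOn_const
  have hball2 : ∀ z ∈ ball x0 r, ‖z‖ < 2 := fun z hz => by simpa using (hrb hz).2
  have hM := hVs x0 hx0H r hr (fun z hz => (hrb hz).1) φ (hφ2.mono fun z hz => (hrb hz).1)
    (by simp only [hφ, hm]; ring) (by
      intro y hy
      have := hmin y (by simpa using (hball2 y hy).le)
      simp only [hφ]; linarith)
  set F : EE d → ℝ := fun y => if ‖y - x0‖ < r then φ y else V y with hF
  have hφc : Continuous φ := by simp only [hφ]; fun_prop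
  have hFm : Measurable F :=
    Measurable.ite (measurableSet_lt (by fun_prop) (by fun_prop)) hφc.measurable hVc.measurable
  -- lower bound for F
  set g : EE d → ℝ := (AA d).indicator V with hg
  have hAm : MeasurableSet (AA d) := isClosed_closedBall.measurableSet
  have hg0 : ∀ z, 0 ≤ g z := by
    intro z; apply indicator_nonneg; intro z hz; exact hV8 z (by linarith [(AA_norm hz).2])
  set T : EE d → ℝ := fun z => if 8 ≤ ‖z‖ then ‖z‖ ^ (3*s/2) else 0 with hT
  have hgi : Integrable g := by
    rw [hg, integrable_indicator_iff hAm]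
    exact hVc.continuousOn.integrableOn_compact (isCompact_closedBall _ _)
  have hFlow : ∀ z, ε * psi d s z + m + g z - τ * T z ≤ F z := by
    intro z
    simp only [hF, hφ, hT]
    by_cases hz2 : ‖z‖ ≤ 2
    · have hgz : g z = 0 := indicator_of_notMem (fun h => by linarith [(AA_norm h).1]) _
      have := hmin z (by simpa using hz2)
      rw [hgz, if_neg (by linarith : ¬ 8 ≤ ‖z‖)]
      split_ifs <;> linarith
    · push Not at hz2
      have hnb : ¬ ‖z - x0‖ < r := fun h => by
        have := hball2 z (by simpa [dist_eq_norm] using h)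
        linarith
      rw [if_neg hnb, hψ2 z hz2.le]
      by_cases h8 : 8 ≤ ‖z‖
      · have hgz : g z = 0 := indicator_of_notMem (fun h => by linarith [(AA_norm h).2]) _
        have := hVτ z h8
        rw [if_pos h8, hgz]; linarith
      · rw [if_neg h8]
        have h0 := hV8 z (by linarith)
        by_cases hzA : z ∈ AA d
        · have hgz : g z = V z := indicator_of_mem hzA _
          rw [hgz]; linarith
        · have hgz : g z = 0 := indicator_of_notMem hzA _
          rw [hgz]; linarith
  have hFx0 : F x0 = ε * psi d s x0 + m := by simp [hF, hφ, hr]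
  have hFK : ∀ z, |F z| ≤ (ε + |m| + K) * (1 + ‖z‖) ^ (3*s/2) := by
    intro z
    have h1 : 1 ≤ (1 + ‖z‖) ^ (3*s/2) := Real.one_le_rpow (by linarith [norm_nonneg z]) (by linarith)
    have hK0 := hVK z
    have hK1 := (abs_nonneg _).trans hK0
    have hψ : |psi d s z| ≤ (1 + ‖z‖) ^ (3*s/2) := by
      have := pp_le hs0 (le_refl (0:ℝ)) z
      simp only [add_zero, Real.one_rpow, one_mul] at this
      unfold psi
      rw [abs_mul, abs_of_nonneg (bmp d).nonneg, abs_of_nonneg (pp_nonneg _ _)]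
      calc _ ≤ 1 * pp s (z (Fin.last d)) := by
            gcongr
            · exact pp_nonneg _ _
            · exact (bmp d).le_one
        _ ≤ _ := by linarith
    have h2 : |m| ≤ |m| * (1 + ‖z‖) ^ (3*s/2) := le_mul_of_one_le_right (abs_nonneg _) h1
    simp only [hF, hφ]
    split_ifs
    · refine (abs_add_le _ _).trans ?_
      rw [abs_mul, abs_of_pos hε]
      have := mul_le_mul_of_nonneg_left hψ hε.le
      linarith
    · have : 0 ≤ ε * (1 + ‖z‖) ^ (3*s/2) := by positivity
      have : 0 ≤ |m| * (1 + ‖z‖) ^ (3*s/2) := by positivity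
      linarith
  obtain ⟨r1, A1, hr1, hA1, hsd1⟩ := sd_of_contDiffAt (hφ2.contDiffAt ((HS_open d).mem_nhds hx0H))
  have hsdF : ∀ y, ‖y‖ < min r r1 → |sd F x0 y| ≤ A1 * ‖y‖ ^ (2:ℝ) := by
    intro y hy
    have : sd F x0 y = sd φ x0 y := by
      have hy' := lt_of_lt_of_le hy (min_le_left _ _)
      simp only [sd, hF, add_sub_cancel_left, sub_sub_cancel_left, norm_neg, sub_self, norm_zero, hy', hr, if_true]
    rw [this]
    exact hsd1 y (lt_of_lt_of_le hy (min_le_right _ _))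
  have hfin : ∀ μ, SpecOK (d+1) lam Lam μ → c * (∫ z in AA d, V z) - ε * C - τ * (Lam * D) ≤ ∫ y, kint d s μ F x0 y := by
    intro μ hμ
    have hFi : Integrable (kint d s μ F x0) :=
      kint_integrable_growth hs0 hs1 hlam hlL hμ hFm hFK (lt_min hr hr1) hA1 hsdF
    obtain ⟨hψi, hψI⟩ := hC x0 hx0H hx02 μ hμ
    have hga : Integrable (fun y => g (x0 + y)) := hgi.comp_add_left x0
    have hgb : Integrable (fun y => g (x0 - y)) := hgi.comp_sub_left x0
    have i1 := hψi.const_mul ε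
    have i2 := (hga.add hgb).const_mul (c/2)
    have i3 := (hdi.const_mul Lam).const_mul τ
    have hle : ∫ y, (ε * kint d s μ (psi d s) x0 y + c/2 * (g (x0 + y) + g (x0 - y)) - τ * (Lam * dom d s 0 2 4 (3*s/2) 1 y))
        ≤ ∫ y, kint d s μ F x0 y := by
      refine integral_mono_ae ((i1.add i2).sub i3) hFi ?_
      filter_upwards [compl_mem_ae_iff.2 (measure_singleton (0 : EE d))] with y hy0
      have hY : 0 < ‖y‖ := norm_pos_iff.2 hy0
      obtain ⟨hk1, hk2, -⟩ := spec_abs hlam hμ hy0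
      set k := μ (‖y‖⁻¹ • y) / ‖y‖ ^ N with hk
      have hk0 : 0 ≤ k := div_nonneg (by linarith) (by positivity)
      have ek : ∀ u : EE d → ℝ, kint d s μ u x0 y = sd u x0 y * k := by
        intro u; unfold kint; rw [hk, mul_div_assoc]
      have hgk : ∀ z : EE d, ‖y‖ ≤ ‖z‖ + ‖x0‖ → c * g z ≤ g z * k := by
        intro z hz
        by_cases hzA : z ∈ AA d
        · rw [mul_comm]
          apply mul_le_mul_of_nonneg_left _ (hg0 z)
          rw [hc, hk, ← div_eq_mul_inv]
          have := (AA_norm hzA).2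
          have : ‖y‖ ^ N ≤ 7 ^ N := Real.rpow_le_rpow hY.le (by linarith) hN0.le
          exact div_le_div₀ (by linarith) hk1 (by positivity) this
        · have hgz : g z = 0 := indicator_of_notMem hzA _
          rw [hgz]; simp
      have g1 := hgk (x0 + y) (by
        have := norm_sub_le (x0 + y) x0
        rwa [add_sub_cancel_left] at this)
      have g2 := hgk (x0 - y) (by
        have := norm_sub_le (x0 - y) x0
        rwa [sub_sub_cancel_left, norm_neg] at this)
      have hTk : (T (x0 + y) + T (x0 - y))/2 * k ≤ Lam * dom d s 0 2 4 (3*s/2) 1 y := by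
        have hTz : ∀ z : EE d, ‖z‖ ≤ ‖x0‖ + ‖y‖ → T z ≤ if ‖y‖ < 1 then 0 else 4 * ‖y‖ ^ (3*s/2) := by
          intro z hz
          simp only [hT]
          split_ifs with h8 h1 h1
          · linarith
          · calc ‖z‖ ^ (3*s/2) ≤ (2 * ‖y‖) ^ (3*s/2) := by
                  apply Real.rpow_le_rpow (norm_nonneg _) (by linarith) (by linarith)
              _ = 2 ^ (3*s/2) * ‖y‖ ^ (3*s/2) := Real.mul_rpow (by norm_num) hY.le
              _ ≤ 2 ^ (2:ℝ) * ‖y‖ ^ (3*s/2) := by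
                  gcongr
                  · norm_num
                  · linarith
              _ = _ := by norm_num
          · exact le_refl _
          · positivity
        have t1 := hTz (x0 + y) (norm_add_le _ _)
        have t2 := hTz (x0 - y) (norm_sub_le _ _)
        have t3 : (T (x0 + y) + T (x0 - y))/2 ≤ if ‖y‖ < 1 then 0 else 4 * ‖y‖ ^ (3*s/2) := by linarith
        have hkL : k ≤ Lam * ‖y‖ ^ (-N) := by
          rw [hk, Real.rpow_neg hY.le, ← div_eq_mul_inv]; gcongr
        refine (mul_le_mul_of_nonneg_right t3 hk0).trans ?_
        unfold dom
        split_ifs with h1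
        · simp
        · calc _ ≤ 4 * ‖y‖ ^ (3*s/2) * (Lam * ‖y‖ ^ (-N)) := by gcongr
            _ = Lam * (4 * (‖y‖ ^ (3*s/2) * ‖y‖ ^ (-N))) := by ring
            _ = _ := by
              rw [← Real.rpow_add hY, hN]; push_cast; simp; left; congr 1; ring
      have hsdl : ε * sd (psi d s) x0 y + (g (x0+y) + g (x0-y))/2 - τ * ((T (x0 + y) + T (x0 - y))/2) ≤ sd F x0 y := by
        have f1 := hFlow (x0 + y)
        have f2 := hFlow (x0 - y)
        unfold sd; rw [hFx0]; linarith
      have hmul := mul_le_mul_of_nonneg_right hsdl hk0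
      simp only [ek]
      have := mul_le_mul_of_nonneg_left hTk hτ
      nlinarith
    have hsum : ∫ y, (ε * kint d s μ (psi d s) x0 y + c/2 * (g (x0 + y) + g (x0 - y)) - τ * (Lam * dom d s 0 2 4 (3*s/2) 1 y)) =
        ε * (∫ y, kint d s μ (psi d s) x0 y) + c * (∫ z in AA d, V z) - τ * (Lam * D) := by
      have j1 := integral_sub (i1.add i2) i3
      have j2 := integral_add i1 i2
      have j3 := integral_add hga hgb
      simp only [Pi.add_apply] at j1 j2 j3
      rw [j1, j2, integral_const_mul, integral_const_mul, j3, integral_const_mul, integral_const_mul,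
        integral_add_left_eq_self g x0, integral_sub_left_eq_self g volume x0, hg, integral_indicator hAm]
      ring
    rw [hsum] at hle
    have := mul_le_mul_of_nonneg_left hψI hε.le
    linarith
  set κ : ℝ := c * (∫ z in AA d, V z) - ε * C - τ * (Lam * D) with hκ
  have hκ0 : 0 < κ := by
    have h1 : c * (ε * ((C + 1) / c) + τ * ((Lam * D + 1) / c)) < c * (∫ z in AA d, V z) := by gcongr
    have h2 : c * (ε * ((C + 1) / c) + τ * ((Lam * D + 1) / c)) = ε * (C+1) + τ * (Lam * D + 1) := by
      field_simp
    rw [h2] at h1; rw [hκ]; linarith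
  have : (1-s) * κ ≤ Mminus (d+1) s lam Lam F x0 := by
    unfold Mminus
    apply le_csInf
    · exact ⟨_, fun _ => lam, ⟨measurable_const, fun θ _ => ⟨rfl, le_refl _, hlL⟩⟩, rfl⟩
    · rintro z ⟨μ, hμ, rfl⟩
      rw [kerOp_eq]
      exact mul_le_mul_of_nonneg_left (hfin μ hμ) (by linarith)
  have h3 : 0 < (1-s) * κ := mul_pos (by linarith) hκ0
  linarith
end

section
variable {d : ℕ} {s lam Lam : ℝ}

lemma w0_cont (d : ℕ) (hs0 : 0 < s) : Continuous fun z : EE d => pp s (z (Fin.last d)) :=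
  (pp_cont hs0).comp (by fun_prop)

lemma w0_pos {x : EE d} (hx : x ∈ HS d) : 0 < pp s (x (Fin.last d)) := by
  have hx : 0 < x (Fin.last d) := hx
  rw [pp_of_pos hx]; positivity

lemma AA_sub : AA d ⊆ HS d := by
  intro z hz
  have h : ‖z - EuclideanSpace.single (Fin.last d) (4:ℝ)‖ ≤ 1 := by simpa [AA, dist_eq_norm] using hz
  have := (coord_le_norm (z - EuclideanSpace.single (Fin.last d) (4:ℝ)) (Fin.last d)).trans h
  simp [abs_le] at this
  change 0 < z (Fin.last d)
  linarith [this.1]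

lemma AA_int_pos (hs0 : 0 < s) : 0 < ∫ z in AA d, pp s (z (Fin.last d)) := by
  have hc : IsCompact (AA d) := isCompact_closedBall _ _
  rw [setIntegral_pos_iff_support_of_nonneg_ae]
  · have : Function.support (fun z : EE d => pp s (z (Fin.last d))) ∩ AA d = AA d := by
      apply inter_eq_right.2
      intro z hz
      exact (w0_pos (AA_sub hz)).ne'
    rw [this]
    exact lt_of_lt_of_le (measure_ball_pos volume _ one_pos) (measure_mono ball_subset_closedBall)
  · exact Filter.Eventually.of_forall fun z => pp_nonneg s _
  · exact (w0_cont d hs0).continuousOn.integrableOn_compact hc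

lemma rpow_sub_one_le {r α : ℝ} (hr : 1 ≤ r) (hs0 : 0 < s) (hα : 0 < α) (hα4 : α ≤ s/4) :
    r ^ α - 1 ≤ 4*α/s * r ^ (s/2) := by
  have hr0 : 0 < r := by linarith
  have h1 : 1 - r ^ (-α) ≤ α * Real.log r := by
    have := Real.add_one_le_exp (-(α * Real.log r))
    rw [Real.rpow_def_of_pos hr0]
    have e : Real.log r * -α = -(α * Real.log r) := by ring
    rw [e]; linarith
  have h2 : Real.log r ≤ r ^ (s/4) / (s/4) := Real.log_le_rpow_div hr0.le (by linarith)
  have h3 : r ^ α * r ^ (-α) = 1 := by rw [← Real.rpow_add hr0]; simp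
  have h4 : r ^ α ≤ r ^ (s/4) := Real.rpow_le_rpow_of_exponent_le hr hα4
  have h5 : r ^ (s/4) * r ^ (s/4) = r ^ (s/2) := by rw [← Real.rpow_add hr0]; ring_nf
  have h6 : 0 < r ^ α := by positivity
  calc r ^ α - 1 = r ^ α * (1 - r ^ (-α)) := by linear_combination h3
    _ ≤ r ^ α * (α * (r ^ (s/4) / (s/4))) := by gcongr; exact h1.trans (by gcongr)
    _ ≤ r ^ (s/4) * (α * (r ^ (s/4) / (s/4))) := by gcongr
    _ = 4*α/s * (r ^ (s/4) * r ^ (s/4)) := by field_simp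
    _ = _ := by rw [h5]

set_option maxHeartbeats 1000000 in
/-- One step of the oscillation decay at unit scale. -/
lemma osc_step (d : ℕ) (hs0 : 0 < s) (hs1 : s < 1) (hlam : 0 < lam) (hlL : lam ≤ Lam) :
    ∃ α0 θ : ℝ, 0 < α0 ∧ α0 ≤ s/4 ∧ 0 < θ ∧ θ < 1 ∧ ∀ (α : ℝ) (G f : EE d → ℝ) (N K : ℝ), 0 < α → α ≤ α0 →
      0 < N → Continuous G → Continuous f → ViscSuper (d+1) s lam Lam G (HS d) →
      ViscSuper (d+1) s lam Lam (fun z => - G z) (HS d) → NullSol d s lam Lam f → (∀ z, 0 ≤ f z) →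
      (∀ z, |G z| ≤ K * (1 + ‖z‖) ^ (3*s/2)) → (∀ z, f z ≤ K * (1 + ‖z‖) ^ (3*s/2)) →
      (∀ z, z (Fin.last d) ≤ 0 → |G z| ≤ f z) →
      (∀ R, 1 ≤ R → ∀ x ∈ HS d, ∀ y ∈ HS d, ‖x‖ ≤ R → ‖y‖ ≤ R →
        (G x - f x) / pp s (x (Fin.last d)) - (G y + f y) / pp s (y (Fin.last d)) ≤ N * R ^ α) →
      ∀ x ∈ HS d, ∀ y ∈ HS d, ‖x‖ ≤ 1 → ‖y‖ ≤ 1 →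
        (G x - f x) / pp s (x (Fin.last d)) - (G y + f y) / pp s (y (Fin.last d)) ≤ θ * N := by
  obtain ⟨C1, C2, hC1, hC2, hGL⟩ := growth_lemma (d := d) hs0 hs1 hlam hlL
  set I0 := ∫ z in AA d, pp s (z (Fin.last d)) with hI0
  have hI0p : 0 < I0 := AA_int_pos hs0
  set c1 := min 1 (min (I0/(8*C1)) (I0/(8*C2))) with hc1
  have hc1p : 0 < c1 := by positivity
  have hc1a : c1 ≤ 1 := min_le_left _ _
  have hc1b : c1 * C1 ≤ I0/8 := by
    have : c1 ≤ I0/(8*C1) := (min_le_right _ _).trans (min_le_left _ _)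
    rw [le_div_iff₀ (by positivity)] at this; linarith
  have hc1c : c1 * C2 ≤ I0/8 := by
    have : c1 ≤ I0/(8*C2) := (min_le_right _ _).trans (min_le_right _ _)
    rw [le_div_iff₀ (by positivity)] at this; linarith
  set c := c1/2 with hc
  have hcp : 0 < c := by positivity
  set α0 := min (s/4) (min (s*I0/(64*C2)) (c/14)) with hα0
  refine ⟨α0, Real.exp (-(c/2)), by positivity, min_le_left _ _, Real.exp_pos _,
    Real.exp_lt_one_iff.2 (by linarith), ?_⟩
  intro α G f N K hα hαle hN hGc hfc hG hG' hf hf0 hGK hfK hGn hP xs hxs ys hys hxs1 hys1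
  have hα4 : α ≤ s/4 := hαle.trans (min_le_left _ _)
  have hαC : 4*α/s*C2 ≤ I0/16 := by
    have : α ≤ s*I0/(64*C2) := hαle.trans ((min_le_right _ _).trans (min_le_left _ _))
    rw [le_div_iff₀ (by positivity)] at this
    rw [div_mul_eq_mul_div, div_le_iff₀ hs0]; linarith
  have hαc : α ≤ c/14 := hαle.trans ((min_le_right _ _).trans (min_le_right _ _))
  set M := N * 8 ^ α with hM
  have hMp : 0 < M := by positivity
  have hθ : (1 - c) * M ≤ Real.exp (-(c/2)) * N := by
    have h8 : (8:ℝ)^α ≤ Real.exp (c/2) := by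
      rw [Real.rpow_def_of_pos (by norm_num)]
      apply Real.exp_le_exp.2
      have := Real.log_le_sub_one_of_pos (show (0:ℝ) < 8 by norm_num)
      nlinarith
    have hcc : 1 - c ≤ Real.exp (-c) := by have := Real.add_one_le_exp (-c); linarith
    have : Real.exp (-(c/2)) = Real.exp (-c) * Real.exp (c/2) := by rw [← Real.exp_add]; ring_nf
    rw [this, hM]
    have h0 : 0 ≤ N * 8^α := hMp.le
    calc (1-c) * (N * 8^α) ≤ Real.exp (-c) * (N * 8^α) := by gcongr
      _ ≤ Real.exp (-c) * (N * Real.exp (c/2)) := by gcongr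
      _ = _ := by ring
  refine le_trans ?_ hθ
  by_contra hlt
  push Not at hlt
  set w : EE d → ℝ := fun z => pp s (z (Fin.last d)) with hw
  have hwp : ∀ z ∈ HS d, 0 < w z := fun z hz => w0_pos hz
  have hw0 : ∀ z, 0 ≤ w z := fun z => pp_nonneg s _
  have hwn : ∀ z : EE d, z (Fin.last d) ≤ 0 → w z = 0 := fun z hz => pp_of_nonpos hs0 hz
  have hwN := null_w0 (d := d) hs0 hs1 hlam hlL
  have hwc : Continuous w := w0_cont d hs0
  change ∀ R, 1 ≤ R → ∀ x ∈ HS d, ∀ y ∈ HS d, ‖x‖ ≤ R → ‖y‖ ≤ R →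
        (G x - f x) / w x - (G y + f y) / w y ≤ N * R ^ α at hP
  change (1 - c) * M < (G xs - f xs) / w xs - (G ys + f ys) / w ys at hlt
  set Sup := (fun x => (G x - f x) / w x) '' {x | x ∈ HS d ∧ ‖x‖ ≤ 8} with hSup
  set Slo := (fun x => (G x + f x) / w x) '' {x | x ∈ HS d ∧ ‖x‖ ≤ 8} with hSlo
  have hP8 : ∀ p ∈ Sup, ∀ q ∈ Slo, p ≤ q + M := by
    rintro _ ⟨x, ⟨hx, hx8⟩, rfl⟩ _ ⟨y, ⟨hy, hy8⟩, rfl⟩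
    have := hP 8 (by norm_num) x hx y hy hx8 hy8
    simp only; linarith
  have hxS : (G xs - f xs) / w xs ∈ Sup := ⟨xs, ⟨hxs, by linarith⟩, rfl⟩
  have hyS : (G ys + f ys) / w ys ∈ Slo := ⟨ys, ⟨hys, by linarith⟩, rfl⟩
  have hba : BddAbove Sup := ⟨_, fun p hp => hP8 p hp _ hyS⟩
  have hbb : BddBelow Slo := ⟨(G xs - f xs) / w xs - M, fun q hq => by have := hP8 _ hxS q hq; linarith⟩
  set b := sSup Sup with hb
  set a := sInf Slo with ha
  have hbx : (G xs - f xs) / w xs ≤ b := le_csSup hba hxS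
  have hay : a ≤ (G ys + f ys) / w ys := csInf_le hbb hyS
  have hbaM : b - a ≤ M := by
    have : b - M ≤ a := by
      apply le_csInf ⟨_, hyS⟩
      intro q hq
      have : b ≤ q + M := csSup_le ⟨_, hxS⟩ fun p hp => hP8 p hp q hq
      linarith
    linarith
  have hbaL : (1 - c) * M < b - a := by linarith
  have hM2 : M ≤ 2 * (b - a) := by nlinarith
  have hbap : 0 < b - a := by linarith
  set τ := M * (4*α/s + c) with hτ
  have hτ0 : 0 ≤ τ := by positivity
  set ε := c1 * (b - a) with hε
  have hεp : 0 < ε := by positivity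
  have hcond : ε * C1 + τ * C2 < (b - a) * I0 / 2 := by
    have e1 : ε * C1 ≤ (b-a) * (I0/8) := by
      rw [hε]; nlinarith
    have e2 : τ * C2 ≤ (b-a) * (I0/4) := by
      have : (4*α/s + c) * C2 ≤ I0/8 := by rw [hc]; linarith
      have h0 : 0 ≤ (4*α/s + c) * C2 := by positivity
      calc τ * C2 = M * ((4*α/s + c) * C2) := by rw [hτ]; ring
        _ ≤ (2*(b-a)) * (I0/8) := by gcongr
        _ = _ := by ring
    nlinarith [mul_pos hbap hI0p]
  -- tails
  have tail : ∀ V : EE d → ℝ, (∀ z, z (Fin.last d) ≤ 0 → 0 ≤ V z) →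
      (∀ z ∈ HS d, 8 ≤ ‖z‖ → ((b - a) - N * ‖z‖ ^ α) * w z ≤ V z) →
      ∀ z, 8 ≤ ‖z‖ → -(τ * ‖z‖ ^ (3*s/2)) ≤ V z := by
    intro V hVn hVz z hz
    have hz0 : 0 < ‖z‖ := by linarith
    by_cases hzH : z ∈ HS d
    · refine le_trans ?_ (hVz z hzH hz)
      have h1 : N * ‖z‖ ^ α = M * (‖z‖/8) ^ α := by
        rw [hM, Real.div_rpow hz0.le (by norm_num)]; field_simp
      have h2 := rpow_sub_one_le (r := ‖z‖/8) (by linarith) hs0 hα hα4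
      have h3 : (‖z‖/8) ^ (s/2) ≤ ‖z‖ ^ (s/2) := by
        apply Real.rpow_le_rpow <;> linarith
      have h4 : 1 ≤ ‖z‖ ^ (s/2) := Real.one_le_rpow (by linarith) (by linarith)
      have h5 : w z ≤ ‖z‖ ^ s := w0_le hs0 z
      have h6 : ‖z‖ ^ (s/2) * ‖z‖ ^ s = ‖z‖ ^ (3*s/2) := by rw [← Real.rpow_add hz0]; ring_nf
      have h7 : (‖z‖/8) ^ α - 1 + c ≤ (4*α/s + c) * ‖z‖ ^ (s/2) := by
        have : 4*α/s * (‖z‖/8) ^ (s/2) ≤ 4*α/s * ‖z‖ ^ (s/2) := by gcongr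
        have hcz : c * 1 ≤ c * ‖z‖ ^ (s/2) := by gcongr
        linarith
      have h8 : -(M * ((4*α/s + c) * ‖z‖ ^ (s/2))) ≤ (b - a) - N * ‖z‖ ^ α := by
        rw [h1]
        have := mul_le_mul_of_nonneg_left h7 hMp.le
        linarith
      calc -(τ * ‖z‖ ^ (3*s/2)) = -(M * ((4*α/s + c) * ‖z‖ ^ (s/2)) * ‖z‖ ^ s) := by
            rw [← h6, hτ]; ring
        _ ≤ -(M * ((4*α/s + c) * ‖z‖ ^ (s/2)) * w z) := by
            apply neg_le_neg; gcongr
        _ = -(M * ((4*α/s + c) * ‖z‖ ^ (s/2))) * w z := by ring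
        _ ≤ _ := mul_le_mul_of_nonneg_right h8 (hw0 z)
    · have := hVn z (not_lt.1 hzH)
      have : 0 ≤ τ * ‖z‖ ^ (3*s/2) := by positivity
      linarith
  have hwK : ∀ z : EE d, w z ≤ (1 + ‖z‖) ^ (3*s/2) := by
    intro z
    refine (w0_le hs0 z).trans ?_
    calc ‖z‖ ^ s ≤ (1 + ‖z‖) ^ s := Real.rpow_le_rpow (norm_nonneg _) (by linarith) hs0.le
      _ ≤ _ := Real.rpow_le_rpow_of_exponent_le (by linarith [norm_nonneg z]) (by linarith)
  have VK : ∀ (k : ℝ) (H : EE d → ℝ), (∀ z, |H z| ≤ K * (1 + ‖z‖) ^ (3*s/2)) →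
      ∀ z, |H z + (k * w z + f z)| ≤ (2*K + |k|) * (1 + ‖z‖) ^ (3*s/2) := by
    intro k H hH z
    have h1 := hH z
    have h2 := hfK z
    have h3 := mul_le_mul_of_nonneg_left (hwK z) (abs_nonneg k)
    calc |H z + (k * w z + f z)| ≤ |H z| + (|k| * w z + f z) := by
          refine (abs_add_le _ _).trans ?_
          gcongr
          refine (abs_add_le _ _).trans ?_
          rw [abs_mul, abs_of_nonneg (hw0 z), abs_of_nonneg (hf0 z)]
      _ ≤ _ := by linarith
  have hV1n : ∀ z, z (Fin.last d) ≤ 0 → 0 ≤ -G z + (b * w z + f z) := by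
    intro z hz
    have := hGn z hz
    rw [hwn z hz]; linarith [le_abs_self (G z)]
  have hV2n : ∀ z, z (Fin.last d) ≤ 0 → 0 ≤ G z + (-a * w z + f z) := by
    intro z hz
    have := hGn z hz
    rw [hwn z hz]; linarith [neg_abs_le (G z)]
  have hIsum : (b - a) * I0 ≤ (∫ z in AA d, (-G z + (b * w z + f z))) + ∫ z in AA d, (G z + (-a * w z + f z)) := by
    have hc : IsCompact (AA d) := isCompact_closedBall _ _
    rw [← integral_add, ← integral_const_mul]
    · apply integral_mono
      · exact (continuous_const.mul hwc).continuousOn.integrableOn_compact hc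
      · exact (Continuous.continuousOn (by fun_prop)).integrableOn_compact hc
      · intro z
        have := hf0 z
        simp only; change (b - a) * w z ≤ _
        linarith
    · exact (Continuous.continuousOn (by fun_prop)).integrableOn_compact hc
    · exact (Continuous.continuousOn (by fun_prop)).integrableOn_compact hc
  have hfin : b - a - ε ≤ (1 - c) * M := by
    rw [hε, hc]; nlinarith
  rcases le_total (∫ z in AA d, (G z + (-a * w z + f z))) (∫ z in AA d, (-G z + (b * w z + f z))) with hle | hle
  · have := hGL (fun z => -G z + (b * w z + f z)) (2*K + |b|) τ ε (by fun_prop)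
      (VK b (fun z => - G z) (by simpa using hGK)) (hG'.add_null ((hwN.smul b).add hf)) hV1n (by
        intro z hz8
        by_cases hz : z ∈ HS d
        · have : (G z - f z) / w z ≤ b := le_csSup hba ⟨z, ⟨hz, hz8⟩, rfl⟩
          rw [div_le_iff₀ (hwp z hz)] at this
          linarith
        · exact hV1n z (not_lt.1 hz)) hτ0 (tail _ hV1n (by
        intro z hz hz8
        have : (G z - f z) / w z - N * ‖z‖ ^ α ≤ a := by
          apply le_csInf ⟨_, hyS⟩
          rintro _ ⟨y, ⟨hy, hy8⟩, rfl⟩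
          have := hP ‖z‖ (by linarith) z hz y hy le_rfl (hy8.trans hz8)
          simp only; linarith
        have h2 : (G z - f z) / w z ≤ a + N * ‖z‖ ^ α := by linarith
        rw [div_le_iff₀ (hwp z hz)] at h2
        linarith)) hεp (by linarith) xs hxs hxs1
    change ε * w xs ≤ -G xs + (b * w xs + f xs) at this
    have h2 : (G xs - f xs) / w xs ≤ b - ε := by
      rw [div_le_iff₀ (hwp xs hxs)]; linarith
    linarith
  · have := hGL (fun z => G z + (-a * w z + f z)) (2*K + |-a|) τ ε (by fun_prop)
      (VK (-a) G hGK) (hG.add_null ((hwN.smul (-a)).add hf)) hV2n (by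
        intro z hz8
        by_cases hz : z ∈ HS d
        · have : a ≤ (G z + f z) / w z := csInf_le hbb ⟨z, ⟨hz, hz8⟩, rfl⟩
          rw [le_div_iff₀ (hwp z hz)] at this
          linarith
        · exact hV2n z (not_lt.1 hz)) hτ0 (tail _ hV2n (by
        intro z hz hz8
        have : b ≤ (G z + f z) / w z + N * ‖z‖ ^ α := by
          apply csSup_le ⟨_, hxS⟩
          rintro _ ⟨y, ⟨hy, hy8⟩, rfl⟩
          have := hP ‖z‖ (by linarith) y hy z hz (hy8.trans hz8) le_rfl
          simp only; linarith
        have h2 : b - N * ‖z‖ ^ α ≤ (G z + f z) / w z := by linarith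
        rw [le_div_iff₀ (hwp z hz)] at h2
        linarith)) hεp (by linarith) ys hys hys1
    change ε * w ys ≤ G ys + (-a * w ys + f ys) at this
    have h2 : a + ε ≤ (G ys + f ys) / w ys := by
      rw [le_div_iff₀ (hwp ys hys)]; linarith
    linarith

end

section
variable {d : ℕ} {s lam Lam : ℝ}

lemma pp_scale {R : ℝ} (hR : 0 < R) {z : ℝ} (hz : 0 < z) : pp s (R * z) = R ^ s * pp s z := by
  rw [pp_of_pos hz, pp_of_pos (by positivity), Real.mul_rpow hR.le hz.le]

/-- Liouville lemma for translates. -/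
lemma liouville (d : ℕ) (hs0 : 0 < s) (hs1 : s < 1) (hlam : 0 < lam) (hlL : lam ≤ Lam) :
    ∃ α0 : ℝ, 0 < α0 ∧ ∀ (α : ℝ) (G f : EE d → ℝ) (N K : ℝ), 0 < α → α ≤ α0 →
      Continuous G → Continuous f → ViscSuper (d+1) s lam Lam G (HS d) →
      ViscSuper (d+1) s lam Lam (fun z => - G z) (HS d) → NullSol d s lam Lam f → (∀ z, 0 ≤ f z) →
      (∀ z, f z ≤ K * (1 + ‖z‖) ^ (3*s/2)) →
      (∀ R, 1 ≤ R → ∀ z, ‖z‖ ≤ R → |G z| ≤ N * R ^ α * pp s (z (Fin.last d)) + f z) →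
      ∃ c : ℝ, ∀ z ∈ HS d, |G z - c * pp s (z (Fin.last d))| ≤ f z := by
  obtain ⟨α0, θ, hα0, hα4, hθ0, hθ1, hstep⟩ := osc_step d hs0 hs1 hlam hlL
  refine ⟨α0, hα0, ?_⟩
  intro α G f N K hα hαle hGc hfc hG hG' hf hf0 hfK hGb
  have hGn : ∀ z : EE d, z (Fin.last d) ≤ 0 → |G z| ≤ f z := by
    intro z hz
    have := hGb (1 + ‖z‖) (by linarith [norm_nonneg z]) z (by linarith)
    rwa [pp_of_nonpos hs0 hz, mul_zero, zero_add] at this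
  have hGK : ∀ z : EE d, |G z| ≤ (|N| + |K|) * (1 + ‖z‖) ^ (3*s/2) := by
    intro z
    have h1 := hGb (1 + ‖z‖) (by linarith [norm_nonneg z]) z (by linarith)
    have h0 : 0 < 1 + ‖z‖ := by linarith [norm_nonneg z]
    have h2 : pp s (z (Fin.last d)) ≤ (1 + ‖z‖) ^ s :=
      (w0_le hs0 z).trans (Real.rpow_le_rpow (norm_nonneg _) (by linarith) hs0.le)
    have h3 : (1 + ‖z‖) ^ α * (1 + ‖z‖) ^ s ≤ (1 + ‖z‖) ^ (3*s/2) := by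
      rw [← Real.rpow_add h0]
      exact Real.rpow_le_rpow_of_exponent_le (by linarith [norm_nonneg z]) (by linarith)
    have h4 : N * (1 + ‖z‖) ^ α * pp s (z (Fin.last d)) ≤ |N| * (1 + ‖z‖) ^ (3*s/2) := by
      have := pp_nonneg s (z (Fin.last d))
      calc N * (1 + ‖z‖) ^ α * pp s (z (Fin.last d)) ≤ |N| * (1 + ‖z‖) ^ α * pp s (z (Fin.last d)) := by
            gcongr; exact le_abs_self N
        _ ≤ |N| * (1 + ‖z‖) ^ α * (1 + ‖z‖) ^ s := by gcongr
        _ = |N| * ((1 + ‖z‖) ^ α * (1 + ‖z‖) ^ s) := by ring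
        _ ≤ _ := by gcongr
    have h5 : K * (1 + ‖z‖) ^ (3*s/2) ≤ |K| * (1 + ‖z‖) ^ (3*s/2) := by
      gcongr; exact le_abs_self K
    linarith [hfK z]
  have hfK' : ∀ z : EE d, f z ≤ (|N| + |K|) * (1 + ‖z‖) ^ (3*s/2) := by
    intro z
    refine (hfK z).trans ?_
    have h0 : 0 < 1 + ‖z‖ := by linarith [norm_nonneg z]
    gcongr
    linarith [le_abs_self K, abs_nonneg N]
  set K' := |N| + |K| with hK'
  have hK0 : 0 ≤ K' := by positivity
  have hiter : ∀ k : ℕ, ∀ R, 1 ≤ R → ∀ x ∈ HS d, ∀ y ∈ HS d, ‖x‖ ≤ R → ‖y‖ ≤ R →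
        (G x - f x) / pp s (x (Fin.last d)) - (G y + f y) / pp s (y (Fin.last d)) ≤
          θ ^ k * (2 * (|N| + 1)) * R ^ α := by
    intro k
    induction k with
    | zero =>
      intro R hR x hx y hy hxR hyR
      have h1 := hGb R hR x hxR
      have h2 := hGb R hR y hyR
      have wx := w0_pos (s := s) hx
      have wy := w0_pos (s := s) hy
      have hRα : 0 < R ^ α := by positivity
      have h3 : (G x - f x) / pp s (x (Fin.last d)) ≤ N * R ^ α := by
        rw [div_le_iff₀ wx]; linarith [le_abs_self (G x)]
      have h4 : - (N * R ^ α) ≤ (G y + f y) / pp s (y (Fin.last d)) := by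
        rw [le_div_iff₀ wy]; linarith [neg_abs_le (G y)]
      have h5 : N * R ^ α ≤ (|N| + 1) * R ^ α := by
        gcongr; linarith [le_abs_self N]
      rw [pow_zero]; linarith
    | succ k ih =>
      intro R hR x hx y hy hxR hyR
      have hR0 : 0 < R := by linarith
      have hinv : ∀ z : EE d, R • R⁻¹ • z = z := fun z => by rw [smul_smul, mul_inv_cancel₀ hR0.ne', one_smul]
      have hnorm : ∀ z : EE d, ‖R • z‖ = R * ‖z‖ := fun z => by
        rw [norm_smul, Real.norm_eq_abs, abs_of_pos hR0]
      have hdiv : ∀ (A : ℝ) (z : EE d), z ∈ HS d → A / pp s (z (Fin.last d)) =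
          R ^ s * (A / pp s ((R • z) (Fin.last d))) := by
        intro A z hz
        have hz : 0 < z (Fin.last d) := hz
        have e : (R • z) (Fin.last d) = R * z (Fin.last d) := rfl
        rw [e, pp_scale hR0 hz]
        have : 0 < pp s (z (Fin.last d)) := w0_pos hz
        have : 0 < R ^ s := by positivity
        field_simp
      have hgr : ∀ z : EE d, K' * (1 + ‖R • z‖) ^ (3*s/2) ≤ K' * R ^ (3*s/2) * (1 + ‖z‖) ^ (3*s/2) := by
        intro z
        rw [mul_assoc, ← Real.mul_rpow hR0.le (by positivity), hnorm]
        gcongr; linarith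
      have hres := hstep α (fun z => G (R • z)) (fun z => f (R • z)) (θ ^ k * (2 * (|N| + 1)) * R ^ (s + α))
        (K' * R ^ (3*s/2)) hα hαle (by positivity) (by fun_prop) (by fun_prop) (hG.scale hR0) (hG'.scale hR0)
        (hf.scale hR0) (fun z => hf0 _) (fun z => (hGK _).trans (hgr z)) (fun z => (hfK' _).trans (hgr z))
        (fun z hz => hGn _ (by
          have e : (R • z) (Fin.last d) = R * z (Fin.last d) := rfl
          rw [e]; nlinarith)) (by
        intro R' hR' x hx y hy hxR hyR
        have := ih (R * R') (by nlinarith) (R • x) (HS_smul hR0 hx) (R • y) (HS_smul hR0 hy)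
          (by rw [hnorm]; gcongr) (by rw [hnorm]; gcongr)
        simp only
        rw [hdiv _ x hx, hdiv _ y hy, ← mul_sub]
        rw [Real.mul_rpow hR0.le (by linarith)] at this
        rw [Real.rpow_add hR0]
        have h3 := mul_le_mul_of_nonneg_left this (by positivity : 0 ≤ R ^ s)
        exact h3.trans (le_of_eq (by ring)))
        (R⁻¹ • x) (HS_smul (by positivity) hx) (R⁻¹ • y) (HS_smul (by positivity) hy)
        (by
          rw [norm_smul, Real.norm_eq_abs, abs_of_pos (by positivity), inv_mul_le_iff₀ hR0]; linarith)
        (by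
          rw [norm_smul, Real.norm_eq_abs, abs_of_pos (by positivity), inv_mul_le_iff₀ hR0]; linarith)
      simp only at hres
      rw [hdiv _ _ (HS_smul (by positivity) hx), hdiv _ _ (HS_smul (by positivity) hy), ← mul_sub, hinv, hinv,
        Real.rpow_add hR0] at hres
      have hRs : 0 < R ^ s := by positivity
      refine le_of_mul_le_mul_left (hres.trans (le_of_eq ?_)) hRs
      rw [pow_succ]; ring
  have hord : ∀ x ∈ HS d, ∀ y ∈ HS d,
      (G x - f x) / pp s (x (Fin.last d)) ≤ (G y + f y) / pp s (y (Fin.last d)) := by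
    intro x hx y hy
    set R := 1 + ‖x‖ + ‖y‖ with hR
    have hnx := norm_nonneg x
    have hny := norm_nonneg y
    have hk := fun k => hiter k R (by linarith) x hx y hy (by linarith) (by linarith)
    have ht : Filter.Tendsto (fun k : ℕ => θ ^ k * (2 * (|N| + 1)) * R ^ α) Filter.atTop (nhds (0 * (2 * (|N| + 1)) * R ^ α)) :=
      ((tendsto_pow_atTop_nhds_zero_of_lt_one hθ0.le hθ1).mul_const _).mul_const _
    have := ge_of_tendsto' ht hk
    linarith
  set S := (fun x => (G x - f x) / pp s (x (Fin.last d))) '' HS d with hS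
  refine ⟨sSup S, ?_⟩
  intro z hz
  have hwz := w0_pos (s := s) hz
  have hb : BddAbove S := ⟨(G z + f z) / pp s (z (Fin.last d)), by
    rintro _ ⟨x, hx, rfl⟩; exact hord x hx z hz⟩
  have hzS : (G z - f z) / pp s (z (Fin.last d)) ∈ S := ⟨z, hz, rfl⟩
  have h1 := le_csSup hb hzS
  have h2 : sSup S ≤ (G z + f z) / pp s (z (Fin.last d)) := csSup_le ⟨_, hzS⟩ (by
    rintro _ ⟨x, hx, rfl⟩; exact hord x hx z hz)
  rw [div_le_iff₀ hwz] at h1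
  rw [le_div_iff₀ hwz] at h2
  rw [abs_le]; constructor <;> linarith
end

section
open Filter Topology

lemma oneD_final {s β A : ℝ} (hs0 : 0 < s) (hs1 : s < 1) (hβ : 0 < β) {U : ℝ → ℝ}
    (hU : Continuous U) (hU0 : U 0 = 0)
    (h : ∀ t, 0 < t → t ≤ 1 → ∃ c : ℝ, ∀ r, 0 < r → |U (r + t) - U r - c * r ^ s| ≤ A * t ^ β * (t * r ^ (s - 1))) :
    ∃ κ : ℝ, ∀ r, 0 < r → U r = κ * r ^ (s + 1) := by
  have h' : ∀ t, ∃ c : ℝ, 0 < t → t ≤ 1 → ∀ r, 0 < r → |U (r + t) - U r - c * r ^ s| ≤ A * t ^ β * (t * r ^ (s - 1)) := by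
    intro t
    by_cases ht : 0 < t ∧ t ≤ 1
    · obtain ⟨c, hc⟩ := h t ht.1 ht.2
      exact ⟨c, fun _ _ => hc⟩
    · exact ⟨0, fun h1 h2 => (ht ⟨h1, h2⟩).elim⟩
  choose c hc using h'
  have hA : 0 ≤ A := by
    have := (abs_nonneg _).trans (hc 1 one_pos le_rfl 1 one_pos)
    simpa using this
  have hev : ∀ᶠ t in 𝓝[>] (0:ℝ), 0 < t ∧ t ≤ 1 := by
    filter_upwards [Ioc_mem_nhdsGT (show (0:ℝ) < 1 by norm_num)] with t ht using ht
  have htβ : Tendsto (fun t : ℝ => t ^ β) (𝓝[>] 0) (𝓝 0) := by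
    have : Tendsto (fun t : ℝ => t ^ β) (𝓝 0) (𝓝 (0 ^ β)) :=
      (Real.continuousAt_rpow_const 0 β (Or.inr hβ.le)).tendsto
    rw [Real.zero_rpow hβ.ne'] at this
    exact this.mono_left nhdsWithin_le_nhds
  have hUi : ∀ a b, IntervalIntegrable U volume a b := fun a b => hU.intervalIntegrable a b
  have hsc : Continuous fun r : ℝ => r ^ s := Real.continuous_rpow_const hs0.le
  set J := ∫ r in (1:ℝ)..2, r ^ s with hJ
  have hJp : 0 < J := by
    apply intervalIntegral.intervalIntegral_pos_of_pos_on (hsc.intervalIntegrable _ _) _ (by norm_num)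
    intro x hx
    have : 0 < x := by linarith [hx.1]
    positivity
  -- integral of difference
  set D : ℝ → ℝ := fun t => (∫ r in (1:ℝ)..(2+t), U r) - ∫ r in (1:ℝ)..(1+t), U r with hD
  have hDd : HasDerivAt D (U 2 - U 1) 0 := by
    have f1 : ∀ a : ℝ, HasDerivAt (fun t => ∫ r in (1:ℝ)..(a+t), U r) (U a) 0 := by
      intro a
      have := intervalIntegral.integral_hasDerivAt_right (hUi 1 (a+0)) (hU.stronglyMeasurableAtFilter _ _) hU.continuousAt
      have h2 := this.comp (0:ℝ) ((hasDerivAt_id (0:ℝ)).const_add a)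
      rw [add_zero, mul_one] at h2
      exact h2
    exact (f1 2).sub (f1 1)
  have hDl : Tendsto (fun t => t⁻¹ * (D t - D 0)) (𝓝[>] 0) (𝓝 (U 2 - U 1)) := by
    have := hasDerivAt_iff_tendsto_slope_zero.1 hDd
    simp only [zero_add, smul_eq_mul] at this
    exact this.mono_left (nhdsWithin_mono _ fun t ht => ne_of_gt ht)
  have hDc : ∀ t, 0 < t → t ≤ 1 → |(D t - D 0) - c t * J| ≤ A * t ^ β * t := by
    intro t ht ht1
    have e : (D t - D 0) - c t * J = ∫ r in (1:ℝ)..2, (U (r + t) - U r - c t * r ^ s) := by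
      rw [intervalIntegral.integral_sub, intervalIntegral.integral_sub, intervalIntegral.integral_const_mul,
        intervalIntegral.integral_comp_add_right]
      · simp only [hD, add_zero, intervalIntegral.integral_same, sub_zero]
        rw [← intervalIntegral.integral_add_adjacent_intervals (hUi 1 (1+t)) (hUi (1+t) (2+t))]
        ring
      all_goals apply Continuous.intervalIntegrable; fun_prop
    rw [e]
    have := intervalIntegral.norm_integral_le_of_norm_le_const (a := (1:ℝ)) (b := 2) (C := A * t ^ β * t)
      (f := fun r => U (r + t) - U r - c t * r ^ s) (by
        intro r hr
        rw [uIoc_of_le (by norm_num)] at hr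
        refine (hc t ht ht1 r (by linarith [hr.1])).trans ?_
        have : r ^ (s - 1) ≤ 1 := Real.rpow_le_one_of_one_le_of_nonpos hr.1.le (by linarith)
        have : t * r ^ (s-1) ≤ t := by nlinarith
        gcongr)
    rw [Real.norm_eq_abs] at this
    refine this.trans (le_of_eq ?_)
    norm_num
  set κ := (U 2 - U 1) / J with hκ
  have hcl : Tendsto (fun t => t⁻¹ * c t) (𝓝[>] 0) (𝓝 κ) := by
    have h1 : Tendsto (fun t => t⁻¹ * (D t - D 0) - t⁻¹ * c t * J) (𝓝[>] 0) (𝓝 0) := by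
      apply squeeze_zero_norm' (a := fun t => A * t ^ β)
      · filter_upwards [hev] with t ht
        have := hDc t ht.1 ht.2
        have e : t⁻¹ * (D t - D 0) - t⁻¹ * c t * J = t⁻¹ * ((D t - D 0) - c t * J) := by ring
        rw [e, norm_mul, Real.norm_eq_abs, Real.norm_eq_abs, abs_of_pos (inv_pos.2 ht.1), inv_mul_le_iff₀ ht.1]
        linarith
      · simpa using htβ.const_mul A
    have h2 := (hDl.sub h1).div_const J
    rw [sub_zero] at h2
    refine h2.congr fun t => ?_
    field_simp; ring
  have hder : ∀ r, 0 < r → HasDerivWithinAt U (κ * r ^ s) (Ici r) r := by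
    intro r hr
    rw [← hasDerivWithinAt_Ioi_iff_Ici, hasDerivWithinAt_iff_tendsto_slope' (by simp)]
    have h1 : Tendsto (fun t => t⁻¹ * (U (r + t) - U r)) (𝓝[>] 0) (𝓝 (κ * r ^ s)) := by
      have h1 : Tendsto (fun t => t⁻¹ * (U (r + t) - U r) - t⁻¹ * c t * r ^ s) (𝓝[>] 0) (𝓝 0) := by
        apply squeeze_zero_norm' (a := fun t => A * t ^ β * r ^ (s-1))
        · filter_upwards [hev] with t ht
          have := hc t ht.1 ht.2 r hr
          have e : t⁻¹ * (U (r + t) - U r) - t⁻¹ * c t * r ^ s = t⁻¹ * (U (r + t) - U r - c t * r ^ s) := by ring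
          rw [e, norm_mul, Real.norm_eq_abs, Real.norm_eq_abs, abs_of_pos (inv_pos.2 ht.1), inv_mul_le_iff₀ ht.1]
          linarith
        · simpa using (htβ.const_mul A).mul_const (r ^ (s-1))
      have h2 := h1.add (hcl.mul_const (r ^ s))
      rw [zero_add] at h2
      refine h2.congr fun t => ?_
      ring
    have h2 : Tendsto (fun y => y - r) (𝓝[>] r) (𝓝[>] 0) := by
      apply tendsto_nhdsWithin_of_tendsto_nhds_of_eventually_within
      · have : Tendsto (fun y => y - r) (𝓝 r) (𝓝 (r - r)) := (continuous_id.sub continuous_const).tendsto r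
        rw [sub_self] at this
        exact this.mono_left nhdsWithin_le_nhds
      · filter_upwards [self_mem_nhdsWithin] with y hy
        have : r < y := hy
        change 0 < y - r
        linarith
    refine (h1.comp h2).congr fun y => ?_
    simp [slope_def_field]; ring
  have hDD : ∀ r, 0 < r → U r = κ / (s + 1) * r ^ (s + 1) := by
    intro y hy
    set W : ℝ → ℝ := fun r => U r - κ / (s + 1) * r ^ (s + 1) with hW
    have hWc : Continuous W := hU.sub (continuous_const.mul (Real.continuous_rpow_const (by linarith)))
    have hWd : ∀ r, 0 < r → HasDerivWithinAt W 0 (Ici r) r := by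
      intro r hr
      have h1 := (Real.hasDerivAt_rpow_const (x := r) (p := s + 1) (Or.inl hr.ne')).const_mul (κ / (s + 1))
      have h2 := (hder r hr).sub h1.hasDerivWithinAt
      have e : κ * r ^ s - κ / (s + 1) * ((s + 1) * r ^ (s + 1 - 1)) = 0 := by
        rw [add_sub_cancel_right]; field_simp; ring
      rw [e] at h2
      exact h2
    have hconst : ∀ r ∈ Ioc 0 y, W r = W y := by
      intro r hr
      exact (constant_of_has_deriv_right_zero hWc.continuousOn
        (fun x hx => hWd x (lt_of_lt_of_le hr.1 hx.1)) y ⟨hr.2, le_rfl⟩).symm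
    have hW0 : W 0 = 0 := by simp [hW, hU0, Real.zero_rpow (show s + 1 ≠ 0 by linarith)]
    have hlim : Tendsto W (𝓝[>] 0) (𝓝 (W 0)) := hWc.continuousAt.tendsto.mono_left nhdsWithin_le_nhds
    have hlim2 : Tendsto W (𝓝[>] 0) (𝓝 (W y)) := by
      apply tendsto_const_nhds.congr'
      filter_upwards [Ioc_mem_nhdsGT hy] with r hr using (hconst r hr).symm
    have := tendsto_nhds_unique hlim2 hlim
    rw [hW0] at this
    simp only [hW] at this
    linarith
  exact ⟨_, hDD⟩

/-- The trace of the quotient at the boundary. -/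
lemma trace_lim {ψ : ℝ → ℝ} {C α β : ℝ} (hC : 0 ≤ C) (hβ : 0 < β)
    (h : ∀ R, 1 ≤ R → ∀ r q, 0 < r → r < R → 0 < q → q < R → |ψ r - ψ q| ≤ C * R ^ α * |r - q| ^ β) :
    ∃ b : ℝ, ∀ R, 1 ≤ R → ∀ r, 0 < r → r < R → |ψ r - b| ≤ C * R ^ α * r ^ β := by
  set q : ℕ → ℝ := fun n => 1 / ((n:ℝ) + 1 + 1) with hq
  have hq0 : ∀ n, 0 < q n := fun n => by simp only [hq]; positivity
  have hq1 : ∀ n, q n < 1 := fun n => by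
    simp only [hq]; rw [div_lt_one (by positivity)]; linarith [(Nat.cast_nonneg n : (0:ℝ) ≤ n)]
  have hqm : ∀ n m, n ≤ m → q m ≤ q n := by
    intro n m hnm
    have : (n:ℝ) ≤ m := by exact_mod_cast hnm
    simp only [hq]; gcongr
  have hql : Tendsto q atTop (𝓝 0) := by
    have := (tendsto_one_div_add_atTop_nhds_zero_nat (𝕜 := ℝ)).comp (tendsto_add_atTop_nat 1)
    refine this.congr fun n => ?_
    simp [hq]
  have hqβ : Tendsto (fun n => q n ^ β) atTop (𝓝 0) := by
    have := hql.rpow_const (p := β) (Or.inr hβ.le)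
    rwa [Real.zero_rpow hβ.ne'] at this
  have hcs : CauchySeq fun n => ψ (q n) := by
    apply cauchySeq_of_le_tendsto_0 (fun n => C * q n ^ β)
    · intro n m N hn hm
      have := h 1 le_rfl (q n) (q m) (hq0 n) (hq1 n) (hq0 m) (hq1 m)
      rw [Real.one_rpow, mul_one] at this
      rw [Real.dist_eq]
      refine this.trans ?_
      have h2 : |q n - q m| ≤ q N := by
        rw [abs_le]; constructor <;> linarith [hqm N n hn, hqm N m hm, hq0 n, hq0 m]
      gcongr
    · simpa using hqβ.const_mul C
  obtain ⟨b, hb⟩ := cauchySeq_tendsto_of_complete hcs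
  refine ⟨b, ?_⟩
  intro R hR r hr hrR
  have h1 : Tendsto (fun n => |ψ r - ψ (q n)|) atTop (𝓝 |ψ r - b|) := (tendsto_const_nhds.sub hb).abs
  have h2 : Tendsto (fun n => C * R ^ α * |r - q n| ^ β) atTop (𝓝 (C * R ^ α * |r - 0| ^ β)) :=
    (((tendsto_const_nhds.sub hql).abs).rpow_const (Or.inr hβ.le)).const_mul _
  rw [sub_zero, abs_of_pos hr] at h2
  exact le_of_tendsto_of_tendsto' h1 h2 fun n => h R hR r (q n) hr hrR (hq0 n) ((hq1 n).trans_le hR)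

end

lemma diff_bound {s α β C : ℝ} (hs0 : 0 < s) (hs1 : s < 1) (hC : 0 ≤ C) (hβ : 0 < β) (hβ1 : β < 1)
    (hα : 0 < α) (hα1 : α ≤ 1) {V : ℝ → ℝ} (hV0 : ∀ z, z ≤ 0 → V z = 0)
    (h1 : ∀ R, 1 ≤ R → ∀ r, 0 < r → r < R → |V r / r ^ s| ≤ C * R ^ α * r ^ β)
    (h2 : ∀ R, 1 ≤ R → ∀ r q, 0 < r → r < R → 0 < q → q < R → |V r / r ^ s - V q / q ^ s| ≤ C * R ^ α * |r - q| ^ β)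
    {t : ℝ} (ht : 0 < t) (ht1 : t ≤ 1) {R r : ℝ} (hR : 1 ≤ R) (hr : r ≤ R) :
    |V (r + t) - V r| ≤ 9 * C * R ^ α * pp s r + 6 * C * t ^ β * ft s t r := by
  have hR0 : 0 < R := by linarith
  have hf0 := ft_nonneg hs0 ht.le r
  have two : ∀ e : ℝ, 0 < e → e ≤ 1 → (2:ℝ) ^ e ≤ 2 := fun e h0 h1 => by
    have := Real.rpow_le_rpow_of_exponent_le (show (1:ℝ) ≤ 2 by norm_num) h1
    simpa using this
  have three : ∀ e : ℝ, 0 < e → e ≤ 1 → (3:ℝ) ^ e ≤ 3 := fun e h0 h1 => by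
    have := Real.rpow_le_rpow_of_exponent_le (show (1:ℝ) ≤ 3 by norm_num) h1
    simpa using this
  have htβ : 0 < t ^ β := by positivity
  rcases le_or_gt r 0 with hr0 | hr0
  · rw [hV0 r hr0, pp_of_nonpos hs0 hr0, sub_zero, mul_zero, zero_add]
    rcases le_or_gt (r + t) 0 with hq | hq
    · rw [hV0 _ hq, abs_zero]; positivity
    · have hft : ft s t r = (r + t) ^ s := by
        unfold ft; rw [pp_of_pos hq, pp_of_nonpos hs0 hr0, sub_zero]
      have := h1 2 (by norm_num) (r + t) hq (by linarith)
      have hps : 0 < (r + t) ^ s := by positivity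
      rw [abs_div, abs_of_pos hps, div_le_iff₀ hps] at this
      rw [hft]
      refine this.trans ?_
      have a1 := two α hα hα1
      have a2 : (r + t) ^ β ≤ t ^ β := Real.rpow_le_rpow hq.le (by linarith) hβ.le
      calc C * 2 ^ α * (r + t) ^ β * (r + t) ^ s ≤ C * 2 * t ^ β * (r + t) ^ s := by gcongr
        _ ≤ 6 * C * t ^ β * (r + t) ^ s := by
          apply mul_le_mul_of_nonneg_right _ hps.le
          nlinarith [mul_nonneg hC htβ.le]
  · have hq : 0 < r + t := by linarith
    have hps : 0 < r ^ s := by positivity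
    have hqs : 0 < (r + t) ^ s := by positivity
    rw [pp_of_pos hr0]
    have hft : ft s t r = (r + t) ^ s - r ^ s := by
      unfold ft; rw [pp_of_pos hq, pp_of_pos hr0]
    have e : V (r + t) - V r = (V (r + t) / (r + t) ^ s - V r / r ^ s) * r ^ s + V (r + t) / (r + t) ^ s * ft s t r := by
      rw [hft]; field_simp; ring
    have h3R : (3 * R) ^ α ≤ 3 * R ^ α := by
      rw [Real.mul_rpow (by norm_num) hR0.le]
      have := three α hα hα1
      gcongr
    have hRα : 0 < R ^ α := by positivity
    have b1 : |(V (r + t) / (r + t) ^ s - V r / r ^ s) * r ^ s| ≤ 3 * C * R ^ α * r ^ s := by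
      rw [abs_mul, abs_of_pos hps]
      have := h2 (3 * R) (by linarith) (r + t) r hq (by linarith) hr0 (by linarith)
      rw [add_sub_cancel_left, abs_of_pos ht] at this
      have ht2 : t ^ β ≤ 1 := Real.rpow_le_one ht.le ht1 hβ.le
      gcongr
      calc _ ≤ C * (3 * R) ^ α * t ^ β := this
        _ ≤ C * (3 * R ^ α) * 1 := by gcongr
        _ = _ := by ring
    have b2 : |V (r + t) / (r + t) ^ s * ft s t r| ≤ 6 * C * R ^ α * r ^ s + 6 * C * t ^ β * ft s t r := by
      rw [abs_mul, abs_of_nonneg hf0]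
      rcases le_total r t with hrt | hrt
      · have h4 := h1 3 (by norm_num) (r + t) hq (by linarith)
        have a1 : (r + t) ^ β ≤ 2 * t ^ β := by
          calc (r + t) ^ β ≤ (2 * t) ^ β := Real.rpow_le_rpow hq.le (by linarith) hβ.le
            _ = 2 ^ β * t ^ β := Real.mul_rpow (by norm_num) ht.le
            _ ≤ _ := by have := two β hβ hβ1.le; gcongr
        have a2 := three α hα hα1
        have h5 : |V (r + t) / (r + t) ^ s| ≤ 6 * C * t ^ β := by
          calc _ ≤ C * 3 ^ α * (r + t) ^ β := h4
            _ ≤ C * 3 * (2 * t ^ β) := by gcongr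
            _ = _ := by ring
        have h6 := mul_le_mul_of_nonneg_right h5 hf0
        have : 0 ≤ 6 * C * R ^ α * r ^ s := by positivity
        linarith
      · have h4 := h1 (3 * R) (by linarith) (r + t) hq (by linarith)
        have a1 : (r + t) ^ β ≤ 2 * r ^ β := by
          calc (r + t) ^ β ≤ (2 * r) ^ β := Real.rpow_le_rpow hq.le (by linarith) hβ.le
            _ = 2 ^ β * r ^ β := Real.mul_rpow (by norm_num) hr0.le
            _ ≤ _ := by have := two β hβ hβ1.le; gcongr
        have h5 : |V (r + t) / (r + t) ^ s| ≤ 6 * C * R ^ α * r ^ β := by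
          calc _ ≤ C * (3 * R) ^ α * (r + t) ^ β := h4
            _ ≤ C * (3 * R ^ α) * (2 * r ^ β) := by gcongr
            _ = _ := by ring
        have h6 : ft s t r ≤ t * r ^ (s - 1) := by
          refine (ft_le2 hs0 hs1 ht.le hr0).trans ?_
          have : 0 ≤ t * r ^ (s - 1) := by positivity
          nlinarith
        have h7 : r ^ β * (t * r ^ (s - 1)) ≤ r ^ s := by
          have e1 : r ^ β * r ^ (s - 1) = r ^ (β - 1) * r ^ s := by
            rw [← Real.rpow_add hr0, ← Real.rpow_add hr0]; ring_nf
          have e2 : r ^ (β - 1) ≤ t ^ (β - 1) := Real.rpow_le_rpow_of_nonpos ht hrt (by linarith)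
          have e3 : t * t ^ (β - 1) = t ^ β := by
            rw [Real.rpow_sub_one ht.ne']; field_simp
          have ht2 : t ^ β ≤ 1 := Real.rpow_le_one ht.le ht1 hβ.le
          calc r ^ β * (t * r ^ (s - 1)) = t * (r ^ β * r ^ (s - 1)) := by ring
            _ = t * r ^ (β - 1) * r ^ s := by rw [e1]; ring
            _ ≤ t * t ^ (β - 1) * r ^ s := by gcongr
            _ ≤ 1 * r ^ s := by rw [e3]; gcongr
            _ = _ := one_mul _
        have h8 : 0 ≤ 6 * C * t ^ β * ft s t r := by positivity
        calc _ ≤ 6 * C * R ^ α * r ^ β * (t * r ^ (s - 1)) := by gcongr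
          _ = 6 * C * R ^ α * (r ^ β * (t * r ^ (s - 1))) := by ring
          _ ≤ 6 * C * R ^ α * r ^ s := by gcongr
          _ ≤ _ := by linarith
    rw [e]
    refine (abs_add_le _ _).trans ?_
    linarith

section
variable {d : ℕ}

/-- The last basis vector. -/
noncomputable def en (d : ℕ) : EE d := EuclideanSpace.single (Fin.last d) (1:ℝ)

lemma en_last : (en d) (Fin.last d) = 1 := by simp [en]

lemma en_norm : ‖en d‖ = 1 := by simp [en]

lemma smul_en_last (r : ℝ) : (r • en d) (Fin.last d) = r := by
  change r * (en d) (Fin.last d) = r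
  rw [en_last, mul_one]

lemma smul_en_norm (r : ℝ) : ‖r • en d‖ = |r| := by
  rw [norm_smul, en_norm, mul_one, Real.norm_eq_abs]

/-- Tangential projection. -/
noncomputable def tp (x : EE d) : EE d := x - x (Fin.last d) • en d

lemma tp_last (x : EE d) : (tp x) (Fin.last d) = 0 := by
  change x (Fin.last d) - (x (Fin.last d) • en d) (Fin.last d) = 0
  rw [smul_en_last, sub_self]

lemma tp_add (x y : EE d) : tp (x + y) = tp x + tp y := by
  unfold tp
  have : (x + y) (Fin.last d) = x (Fin.last d) + y (Fin.last d) := rfl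
  rw [this, add_smul]; abel

lemma tp_en (r : ℝ) : tp (r • en d) = 0 := by
  unfold tp; rw [smul_en_last, sub_self]

lemma tp_split (x : EE d) : x = x (Fin.last d) • en d + tp x := by unfold tp; abel

lemma tp_cont : Continuous (tp : EE d → EE d) := by
  unfold tp; fun_prop

end

section
variable {d : ℕ} {s lam Lam : ℝ}

lemma null_zero (hs0 : 0 < s) (hs1 : s < 1) (hlam : 0 < lam) (hlL : lam ≤ Lam) :
    NullSol d s lam Lam (fun _ => 0) := by
  have := (null_w0 (d := d) hs0 hs1 hlam hlL).smul 0
  simpa using this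

lemma final (d : ℕ) (s lam Lam : ℝ) (hs0 : 0 < s) (hs1 : s < 1) (hlam : 0 < lam) (hlL : lam ≤ Lam) :
    ∃ abar : ℝ, 0 < abar ∧
      ∀ u : EE d → ℝ, Continuous u →
        (∀ h : EE d, 0 ≤ h (Fin.last d) →
          ViscSub (d + 1) s lam Lam (fun x => u (x + h) - u x) (HS d) ∧
          ViscSuper (d + 1) s lam Lam (fun x => u (x + h) - u x) (HS d)) →
        (∀ x : EE d, x (Fin.last d) < 0 → u x = 0) →
        ∀ β α C : ℝ, 0 < β → β < 1 → 0 < α → α < abar →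
          (∀ R : ℝ, 1 ≤ R → ∀ x y : EE d,
            ‖x‖ < R → ‖y‖ < R → 0 < x (Fin.last d) → 0 < y (Fin.last d) →
            |u x / x (Fin.last d) ^ s - u y / y (Fin.last d) ^ s|
              ≤ C * R ^ α * ‖x - y‖ ^ β) →
          ∃ (p : EE d) (b : ℝ), ∀ x : EE d, u x = (max (x (Fin.last d)) 0) ^ s * (⟪p, x⟫ + b) := by
  obtain ⟨α0, hα0, hLL⟩ := liouville d hs0 hs1 hlam hlL
  refine ⟨min α0 1, by positivity, ?_⟩
  intro u hu hvis hneg β α C0 hβ hβ1 hα hαa hH0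
  have hα1 : α ≤ 1 := hαa.le.trans (min_le_right _ _)
  have hαα0 : α ≤ α0 := hαa.le.trans (min_le_left _ _)
  set C := |C0| with hC
  have hCp : 0 ≤ C := abs_nonneg _
  have hH : ∀ R : ℝ, 1 ≤ R → ∀ x y : EE d,
            ‖x‖ < R → ‖y‖ < R → 0 < x (Fin.last d) → 0 < y (Fin.last d) →
            |u x / x (Fin.last d) ^ s - u y / y (Fin.last d) ^ s| ≤ C * R ^ α * ‖x - y‖ ^ β := by
    intro R hR x y h1 h2 h3 h4
    refine (hH0 R hR x y h1 h2 h3 h4).trans ?_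
    gcongr
    exact le_abs_self _
  clear hH0
  have hu0 : ∀ x : EE d, x (Fin.last d) ≤ 0 → u x = 0 := by
    intro x hx
    have hl : Filter.Tendsto (fun δ : ℝ => u (x - δ • en d)) (nhdsWithin 0 (Ioi 0)) (nhds (u (x - (0:ℝ) • en d))) :=
      (Continuous.tendsto (f := fun δ : ℝ => u (x - δ • en d)) (by fun_prop) 0).mono_left nhdsWithin_le_nhds
    have hl2 : Filter.Tendsto (fun δ : ℝ => u (x - δ • en d)) (nhdsWithin 0 (Ioi 0)) (nhds 0) := by
      apply tendsto_const_nhds.congr'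
      filter_upwards [self_mem_nhdsWithin] with δ hδ
      have hδ : 0 < δ := hδ
      refine (hneg _ ?_).symm
      change x (Fin.last d) - (δ • en d) (Fin.last d) < 0
      rw [smul_en_last]; linarith
    have := tendsto_nhds_unique hl hl2
    simpa using this
  -- tangential increments
  have htan : ∀ h : EE d, h (Fin.last d) = 0 → ∃ c : ℝ, ∀ x, u (x + h) - u x = c * pp s (x (Fin.last d)) := by
    intro h hh
    have hlast : ∀ x : EE d, (x + h) (Fin.last d) = x (Fin.last d) := fun x => by
      change x (Fin.last d) + h (Fin.last d) = _
      rw [hh, add_zero]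
    obtain ⟨c, hc⟩ := hLL α (fun x => u (x + h) - u x) (fun _ => 0) (C * (2 + ‖h‖) ^ α * ‖h‖ ^ β) 0 hα hαα0
      (by fun_prop) continuous_const (hvis h hh.ge).2 (hvis h hh.ge).1.neg (null_zero hs0 hs1 hlam hlL)
      (fun _ => le_rfl) (fun z => by simp) (by
        intro R hR z hz
        have hhn := norm_nonneg h
        simp only
        rw [add_zero]
        rcases le_or_gt (z (Fin.last d)) 0 with hz0 | hz0
        · rw [hu0 _ (by rw [hlast]; exact hz0), hu0 z hz0, pp_of_nonpos hs0 hz0]; simp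
        · rw [pp_of_pos hz0]
          have hp : 0 < z (Fin.last d) ^ s := by positivity
          have hzh := norm_add_le z h
          have := hH ((2 + ‖h‖) * R) (by nlinarith) (z + h) z (by nlinarith) (by nlinarith) (by rw [hlast]; exact hz0) hz0
          rw [hlast, add_sub_cancel_left, ← sub_div, abs_div, abs_of_pos hp, div_le_iff₀ hp,
            Real.mul_rpow (by positivity) (by linarith)] at this
          refine this.trans (le_of_eq (by ring)))
    refine ⟨c, fun x => ?_⟩
    rcases le_or_gt (x (Fin.last d)) 0 with hx | hx
    · rw [hu0 _ (by rw [hlast]; exact hx), hu0 x hx, pp_of_nonpos hs0 hx]; simp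
    · have := hc x hx
      have := abs_nonpos_iff.1 this
      linarith
  have hpp1 : pp s 1 = 1 := by rw [pp_of_pos one_pos, Real.one_rpow]
  have htan2 : ∀ h : EE d, h (Fin.last d) = 0 → ∀ x, u (x + h) - u x = (u (en d + h) - u (en d)) * pp s (x (Fin.last d)) := by
    intro h hh x
    obtain ⟨c, hc⟩ := htan h hh
    have := hc (en d)
    rw [en_last, hpp1, mul_one] at this
    rw [this, hc x]
  let ℓ0 : EE d →+ ℝ := AddMonoidHom.mk' (fun x => u (en d + tp x) - u (en d)) (by
    intro x y
    have h1 := htan2 (tp y) (tp_last y) (en d + tp x)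
    have h2 : (en d + tp x) (Fin.last d) = 1 := by
      change (en d) (Fin.last d) + (tp x) (Fin.last d) = 1
      rw [en_last, tp_last, add_zero]
    rw [h2, hpp1, mul_one] at h1
    rw [tp_add, ← add_assoc]
    linarith)
  have hℓ0 : Continuous ℓ0 := by
    change Continuous (fun x => u (en d + tp x) - u (en d))
    have := tp_cont (d := d)
    fun_prop
  set ℓ := ℓ0.toRealLinearMap hℓ0 with hℓ
  have hℓx : ∀ x, ℓ x = u (en d + tp x) - u (en d) := fun x => rfl
  set p := (InnerProductSpace.toDual ℝ (EE d)).symm ℓ with hp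
  have hpx : ∀ x, ⟪p, x⟫ = u (en d + tp x) - u (en d) := fun x => by
    rw [hp, InnerProductSpace.toDual_symm_apply, hℓx]
  have hpe : ∀ r : ℝ, ⟪p, r • en d⟫ = 0 := by
    intro r; rw [hpx, tp_en, add_zero, sub_self]
  set U : ℝ → ℝ := fun r => u (r • en d) with hU
  have hUc : Continuous U := by simp only [hU]; fun_prop
  have hsplit : ∀ x : EE d, u x = U (x (Fin.last d)) + ⟪p, x⟫ * pp s (x (Fin.last d)) := by
    intro x
    have := htan2 (tp x) (tp_last x) (x (Fin.last d) • en d)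
    rw [← tp_split, smul_en_last, ← hpx] at this
    simp only [hU]; linarith
  have hUH : ∀ R, 1 ≤ R → ∀ r q, 0 < r → r < R → 0 < q → q < R →
      |U r / r ^ s - U q / q ^ s| ≤ C * R ^ α * |r - q| ^ β := by
    intro R hR r q hr hrR hq hqR
    have := hH R hR (r • en d) (q • en d) (by rwa [smul_en_norm, abs_of_pos hr]) (by rwa [smul_en_norm, abs_of_pos hq])
      (by rwa [smul_en_last]) (by rwa [smul_en_last])
    rwa [smul_en_last, smul_en_last, ← sub_smul, smul_en_norm] at this
  obtain ⟨b, hb⟩ := trace_lim (ψ := fun r => U r / r ^ s) hCp hβ hUH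
  set V : ℝ → ℝ := fun r => U r - b * pp s r with hV
  have hVc : Continuous V := by
    have := pp_cont hs0
    simp only [hV]; fun_prop
  have hV0 : ∀ z, z ≤ 0 → V z = 0 := by
    intro z hz
    simp only [hV, hU]
    rw [pp_of_nonpos hs0 hz, hu0 _ (by rwa [smul_en_last])]; simp
  have hVdiv : ∀ r, 0 < r → V r / r ^ s = U r / r ^ s - b := by
    intro r hr
    have : 0 < r ^ s := by positivity
    simp only [hV]; rw [pp_of_pos hr]; field_simp
  have hVinc : ∀ t, 0 < t → t ≤ 1 → ∃ c : ℝ, ∀ r, 0 < r →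
      |V (r + t) - V r - c * r ^ s| ≤ (6 * C) * t ^ β * (t * r ^ (s - 1)) := by
    intro t ht ht1
    have hnull := ((null_pft (d := d) hs0 hs1 hlam hlL ht p).add
      ((null_ft (d := d) hs0 hs1 hlam hlL ht.le).smul b))
    have ht' : 0 ≤ (t • en d) (Fin.last d) := by rw [smul_en_last]; exact ht.le
    have hG : ∀ x : EE d, u (x + t • en d) - u x - (⟪p, x⟫ * ft s t (x (Fin.last d)) + b * ft s t (x (Fin.last d))) =
        V (x (Fin.last d) + t) - V (x (Fin.last d)) := by
      intro x
      have e : (x + t • en d) (Fin.last d) = x (Fin.last d) + t := by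
        change x (Fin.last d) + (t • en d) (Fin.last d) = _
        rw [smul_en_last]
      rw [hsplit (x + t • en d), hsplit x, e, inner_add_right, hpe, add_zero]
      simp only [hV]
      unfold ft; ring
    have hGs : ViscSuper (d+1) s lam Lam (fun x : EE d => V (x (Fin.last d) + t) - V (x (Fin.last d))) (HS d) := by
      have := (hvis _ ht').2.add_null (hnull.smul (-1))
      convert this using 2 with x
      rw [← hG]; ring
    have hGs' : ViscSuper (d+1) s lam Lam (fun x : EE d => -(V (x (Fin.last d) + t) - V (x (Fin.last d)))) (HS d) := by
      have := (hvis _ ht').1.neg.add_null hnull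
      convert this using 2 with x
      rw [← hG]; ring
    have hft := ft_cont hs0 t
    have hf0 : ∀ z : EE d, 0 ≤ 6 * C * t ^ β * ft s t (z (Fin.last d)) := fun z => by
      have := ft_nonneg hs0 ht.le (z (Fin.last d))
      positivity
    obtain ⟨c, hc⟩ := hLL α (fun x => V (x (Fin.last d) + t) - V (x (Fin.last d)))
      (fun z => 6 * C * t ^ β * ft s t (z (Fin.last d))) (9 * C) (6 * C * t ^ β * t ^ s) hα hαα0
      (by fun_prop) (by fun_prop) hGs hGs' ((null_ft hs0 hs1 hlam hlL ht.le).smul _) hf0 (by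
        intro z
        have h1 := ft_le hs0 hs1 ht.le (z (Fin.last d))
        have h2 : 1 ≤ (1 + ‖z‖) ^ (3*s/2) := Real.one_le_rpow (by linarith [norm_nonneg z]) (by linarith)
        calc 6 * C * t ^ β * ft s t (z (Fin.last d)) ≤ 6 * C * t ^ β * t ^ s := by gcongr
          _ ≤ _ := le_mul_of_one_le_right (by positivity) h2)
      (by
        intro R hR z hz
        refine diff_bound hs0 hs1 hCp hβ hβ1 hα hα1 hV0 ?_ ?_ ht ht1 hR
          ((le_abs_self _).trans ((coord_le_norm z (Fin.last d)).trans hz))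
        · intro R hR r hr hrR
          rw [hVdiv r hr]; exact hb R hR r hr hrR
        · intro R hR r q hr hrR hq hqR
          rw [hVdiv r hr, hVdiv q hq, sub_sub_sub_cancel_right]; exact hUH R hR r q hr hrR hq hqR)
    refine ⟨c, fun r hr => ?_⟩
    have h1 := hc (r • en d) (by change 0 < (r • en d) (Fin.last d); rwa [smul_en_last])
    simp only [smul_en_last] at h1
    rw [pp_of_pos hr] at h1
    refine h1.trans ?_
    have h2 := ft_le2 hs0 hs1 ht.le hr
    have h3 : 0 ≤ t * r ^ (s - 1) := by positivity
    have h4 : ft s t r ≤ t * r ^ (s - 1) := by nlinarith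
    gcongr
  obtain ⟨κ, hκ⟩ := oneD_final hs0 hs1 hβ hVc (hV0 0 le_rfl) hVinc
  refine ⟨p + κ • en d, b, fun x => ?_⟩
  change u x = pp s (x (Fin.last d)) * _
  have hin : ⟪p + κ • en d, x⟫ = ⟪p, x⟫ + κ * x (Fin.last d) := by
    rw [inner_add_left, real_inner_smul_left]
    simp [en, EuclideanSpace.inner_single_left]
  rw [hin]
  rcases le_or_gt (x (Fin.last d)) 0 with hx | hx
  · rw [hu0 x hx, pp_of_nonpos hs0 hx, zero_mul]
  · have h1 := hκ _ hx
    have h2 := hsplit x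
    simp only [hV] at h1
    rw [Real.rpow_add hx, Real.rpow_one, ← pp_of_pos hx] at h1
    rw [h2]; linear_combination h1

end

/-- Liouville theorem in the half space: there is an exponent `ᾱ > 0` (the boundary
Harnack exponent of the class `L_*(s)`, depending only on `n, s, λ, Λ`) such that if
`u ∈ C(ℝⁿ)` satisfies, in the viscosity sense, `M⁺{u(·+h)-u} ≥ 0` and
`M⁻{u(·+h)-u} ≤ 0` in `{x_n > 0}` for every `h` with `h_n ≥ 0`, vanishes in
`{x_n < 0}`, and enjoys the seminorm growth `[u/(x_n)_+^s]_{C^β(B_R)} ≤ C R^α` for all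
`R ≥ 1`, with `β ∈ (0,1)` and `α ∈ (0,ᾱ)`, then `u(x) = ((x_n)_+)^s (p·x + b)`. -/
theorem stmt12 (d : ℕ) (s lam Lam : ℝ) (hs0 : 0 < s) (hs1 : s < 1)
    (hlam : 0 < lam) (hlL : lam ≤ Lam) :
    ∃ abar : ℝ, 0 < abar ∧
      ∀ u : EuclideanSpace ℝ (Fin (d + 1)) → ℝ, Continuous u →
        (∀ h : EuclideanSpace ℝ (Fin (d + 1)), 0 ≤ h (Fin.last d) →
          ViscSub (d + 1) s lam Lam (fun x => u (x + h) - u x)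
              {x : EuclideanSpace ℝ (Fin (d + 1)) | 0 < x (Fin.last d)} ∧
          ViscSuper (d + 1) s lam Lam (fun x => u (x + h) - u x)
              {x : EuclideanSpace ℝ (Fin (d + 1)) | 0 < x (Fin.last d)}) →
        (∀ x : EuclideanSpace ℝ (Fin (d + 1)), x (Fin.last d) < 0 → u x = 0) →
        ∀ β α C : ℝ, 0 < β → β < 1 → 0 < α → α < abar →
          (∀ R : ℝ, 1 ≤ R → ∀ x y : EuclideanSpace ℝ (Fin (d + 1)),
            ‖x‖ < R → ‖y‖ < R → 0 < x (Fin.last d) → 0 < y (Fin.last d) →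
            |u x / x (Fin.last d) ^ s - u y / y (Fin.last d) ^ s|
              ≤ C * R ^ α * ‖x - y‖ ^ β) →
          ∃ (p : EuclideanSpace ℝ (Fin (d + 1))) (b : ℝ),
            ∀ x : EuclideanSpace ℝ (Fin (d + 1)),
              u x = (max (x (Fin.last d)) 0) ^ s * (⟪p, x⟫ + b) := by
  exact final d s lam Lam hs0 hs1 hlam hlL
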